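/- arXiv:1806.07738 — 2 statements merged into one kernel-verified Lean document; each statement's English description precedes it below -/
import Mathlib

section
/- Let 0 < a < b, let θ ∈ (0, π], and let f be a complex-valued function that is analytic on an open neighborhood of (a,b) ∪ {z ∈ ℂ⁻ : arg(z) ∈ (−θ, 0)} and integrable on (a,b) with respect to Lebesgue measure. Let σ be the complex measure on ℝ with density f·1_{(a,b)} and let G̃_σ(z) = ∫_a^b f(x)/(z−x) dx for z ∉ [a,b]. Then the restriction of G̃_σ to the upper half-plane ℂ⁺ has an analytic continuation G to ℂ⁺ ∪ (a,b) ∪ {z ∈ ℂ⁻ : arg(z) ∈ (−θ, 0)}, and on the sector {z ∈ ℂ⁻ : arg(z) ∈ (−θ, 0)} this continuation satisfies G(z) = G̃_σ(z) − 2πi f(z). -/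
open MeasureTheory Set

/-- The open sector `{z ∈ ℂ⁻ : arg(z) ∈ (-θ, 0)}` in the lower half-plane. -/
def lowerSector (θ : ℝ) : Set ℂ :=
  {z : ℂ | z.im < 0 ∧ -θ < Complex.arg z}

/-- The Cauchy transform `G̃_σ(z) = ∫_a^b f(x)/(z-x) dx` of the complex measure
`σ(dx) = f(x)·1_{(a,b)}(x)dx`. -/
noncomputable def cauchyOfDensity (a b : ℝ) (f : ℂ → ℂ) (z : ℂ) : ℂ :=
  ∫ x in Set.Ioo a b, f (x : ℂ) / (z - (x : ℂ))

open Filter Topology Metric in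
/-- A parametric integral of a dominated family of holomorphic functions is holomorphic. -/
theorem differentiableAt_integral_of_dominated_of_differentiableOn {α : Type*} [MeasurableSpace α]
    {μ : Measure α} {F : ℂ → α → ℂ} {bound : α → ℝ} {z₀ : ℂ} {r : ℝ} (hr : 0 < r)
    (hF_meas : ∀ z ∈ ball z₀ r, AEStronglyMeasurable (F z) μ)
    (h_bound : ∀ᵐ x ∂μ, ∀ z ∈ ball z₀ r, ‖F z x‖ ≤ bound x)
    (bound_integrable : Integrable bound μ)
    (h_diff : ∀ᵐ x ∂μ, DifferentiableOn ℂ (fun z => F z x) (ball z₀ r)) :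
    DifferentiableAt ℂ (fun z => ∫ x, F z x ∂μ) z₀ := by
  have hz₀ : z₀ ∈ ball z₀ r := mem_ball_self hr
  have hF_int : Integrable (F z₀) μ :=
    bound_integrable.mono' (hF_meas z₀ hz₀) (h_bound.mono fun x hx => hx z₀ hz₀)
  have h_meas' : AEStronglyMeasurable (fun x => deriv (fun z => F z x) z₀) μ := by
    set u : ℕ → ℂ := fun n => z₀ + ((r / 2 * (1 / ((n : ℝ) + 1)) : ℝ) : ℂ) with hu
    have hpos : ∀ n : ℕ, 0 < r / 2 * (1 / ((n : ℝ) + 1)) := fun n => by positivity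
    have hu_mem : ∀ n, u n ∈ ball z₀ r := fun n => by
      have h1 : 1 / ((n : ℝ) + 1) ≤ 1 := by
        rw [div_le_one (by positivity)]
        linarith [(Nat.cast_nonneg n : (0 : ℝ) ≤ n)]
      rw [mem_ball, dist_eq_norm, hu, add_sub_cancel_left, Complex.norm_real,
        Real.norm_of_nonneg (hpos n).le]
      nlinarith
    have hu_tend : Tendsto u atTop (𝓝[≠] z₀) := by
      refine tendsto_nhdsWithin_iff.2 ⟨?_, Eventually.of_forall fun n => ?_⟩
      · have h := (tendsto_one_div_add_atTop_nhds_zero_nat (𝕜 := ℝ)).const_mul (r / 2)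
        have h2 := (Complex.continuous_ofReal.tendsto _).comp h
        simpa [hu] using h2.const_add z₀
      · have := (hpos n).ne'
        simp only [hu, mem_compl_iff, mem_singleton_iff, add_eq_left]
        exact_mod_cast this
    refine aestronglyMeasurable_of_tendsto_ae atTop
      (f := fun n x => slope (fun z => F z x) z₀ (u n)) (fun n => ?_) ?_
    · simp only [slope_def_module]
      exact ((hF_meas _ (hu_mem n)).sub (hF_meas _ hz₀)).const_smul ((u n - z₀)⁻¹)
    · filter_upwards [h_diff] with x hx
      exact (hx.differentiableAt (ball_mem_nhds z₀ hr)).hasDerivAt.tendsto_slope.comp hu_tend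
  refine (hasDerivAt_integral_of_dominated_loc_of_deriv_le
    (F' := fun z x => deriv (fun z => F z x) z) (bound := fun x => bound x / (r / 4))
    (ball_mem_nhds z₀ (half_pos hr)) ?_ hF_int h_meas' ?_ (bound_integrable.div_const _)
    ?_).2.differentiableAt
  · filter_upwards [ball_mem_nhds z₀ hr] with z hz using hF_meas z hz
  · filter_upwards [h_bound, h_diff] with x hb hd z hz
    have hsub : closedBall z (r / 4) ⊆ ball z₀ r :=
      closedBall_subset_ball' (by linarith [mem_ball.1 hz])
    refine Complex.norm_deriv_le_of_forall_mem_sphere_norm_le (by positivity) ?_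
      fun w hw => hb w (hsub (sphere_subset_closedBall hw))
    exact (hd.mono hsub).diffContOnCl_ball Subset.rfl
  · filter_upwards [h_diff] with x hd z hz
    exact (hd.differentiableAt (isOpen_ball.mem_nhds
      (ball_subset_ball (by linarith) hz))).hasDerivAt

/-- The Cauchy transform of an integrable density is holomorphic off its support. -/
theorem differentiableAt_setIntegral_div_sub {g : ℝ → ℂ} {S : Set ℝ} (hS : MeasurableSet S)
    (hg : IntegrableOn g S) {z₀ : ℂ} {ε : ℝ} (hε : 0 < ε) (hdist : ∀ x ∈ S, ε ≤ ‖z₀ - x‖) :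
    DifferentiableAt ℂ (fun z : ℂ => ∫ x in S, g x / (z - x)) z₀ := by
  have key : ∀ x ∈ S, ∀ z ∈ Metric.ball z₀ (ε / 2), ε / 2 ≤ ‖z - x‖ := fun x hx z hz => by
    have h1 := hdist x hx
    have h2 : ‖z₀ - z‖ < ε / 2 := by
      rw [← dist_eq_norm, dist_comm]
      exact hz
    have h3 : ‖z₀ - x‖ ≤ ‖z₀ - z‖ + ‖z - x‖ := norm_sub_le_norm_sub_add_norm_sub ..
    linarith
  refine differentiableAt_integral_of_dominated_of_differentiableOn
    (bound := fun x => ‖g x‖ / (ε / 2)) (half_pos hε) (fun z hz => ?_) ?_ (hg.norm.div_const _) ?_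
  · have hm : Measurable fun x : ℝ => (z - (x : ℂ))⁻¹ := by fun_prop
    simp only [div_eq_mul_inv]
    exact hg.aestronglyMeasurable.mul hm.aestronglyMeasurable
  · filter_upwards [ae_restrict_mem hS] with x hx z hz
    rw [norm_div]
    have := key x hx z hz
    gcongr
  · filter_upwards [ae_restrict_mem hS] with x hx z hz
    have h0 : z - x ≠ 0 := norm_pos_iff.1 ((half_pos hε).trans_le (key x hx z hz))
    have hd : DifferentiableAt ℂ (fun w : ℂ => g x / (w - x)) z := by fun_prop (disch := exact h0)
    exact hd.differentiableWithinAt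

theorem dslope_comm_of_field {𝕜 : Type*} [NontriviallyNormedField 𝕜] (f : 𝕜 → 𝕜) (z w : 𝕜) :
    dslope f z w = dslope f w z := by
  rcases eq_or_ne z w with rfl | h
  · rfl
  · rw [dslope_of_ne _ h.symm, dslope_of_ne _ h, slope_comm]

/-- The integral of difference quotients `z ↦ ∫ (f x - f z) / (x - z)` is holomorphic. -/
theorem differentiableOn_setIntegral_dslope {f : ℂ → ℂ} {c : ℂ} {r M : ℝ} {S : Set ℝ}
    (hS : MeasurableSet S) (hS_fin : volume S ≠ ⊤) (hSr : ∀ x ∈ S, (x : ℂ) ∈ Metric.ball c r)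
    (hf : DifferentiableOn ℂ f (Metric.ball c r)) (hM : ∀ z ∈ Metric.ball c r, ‖deriv f z‖ ≤ M) :
    DifferentiableOn ℂ (fun z : ℂ => ∫ x in S, dslope f z x) (Metric.ball c r) := by
  intro z₀ hz₀
  obtain ⟨ε, hε, hsub⟩ := Metric.isOpen_iff.1 Metric.isOpen_ball z₀ hz₀
  refine (differentiableAt_integral_of_dominated_of_differentiableOn
    (bound := fun _ => M) hε (fun z hz => ?_) ?_ ?_ ?_).differentiableWithinAt
  · have hn := Metric.isOpen_ball.mem_nhds (hsub hz)
    have hc : ContinuousOn (dslope f z) (Metric.ball c r) :=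
      (continuousOn_dslope hn).2 ⟨hf.continuousOn, hf.differentiableAt hn⟩
    exact (hc.comp Complex.continuous_ofReal.continuousOn hSr).aestronglyMeasurable hS
  · filter_upwards [ae_restrict_mem hS] with x hx z hz
    rcases eq_or_ne (x : ℂ) z with h | h
    · rw [h, dslope_same]
      exact hM z (hsub hz)
    · rw [dslope_of_ne _ h, slope_def_field, norm_div, div_le_iff₀ (norm_pos_iff.2 (sub_ne_zero.2 h))]
      exact (convex_ball c r).norm_image_sub_le_of_norm_deriv_le
        (fun w hw => hf.differentiableAt (Metric.isOpen_ball.mem_nhds hw)) hM (hsub hz) (hSr x hx)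
  · exact integrableOn_const hS_fin
  · filter_upwards [ae_restrict_mem hS] with x hx
    simp only [dslope_comm_of_field f _ (x : ℂ)]
    exact ((Complex.differentiableOn_dslope (Metric.isOpen_ball.mem_nhds (hSr x hx))).2 hf).mono hsub

theorem setIntegral_one_div_sub_ofReal {p q : ℝ} (hpq : p ≤ q) {z : ℂ} (hz : z.im ≠ 0) :
    ∫ x in Ioo p q, 1 / (z - (x : ℂ)) = Complex.log (z - p) - Complex.log (z - q) := by
  have hne : ∀ x : ℝ, z - x ∈ Complex.slitPlane := fun x => Or.inr (by simpa using hz)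
  rw [← integral_Ioc_eq_integral_Ioo, ← intervalIntegral.integral_of_le hpq,
    intervalIntegral.integral_eq_sub_of_hasDerivAt (f := fun x : ℝ => -Complex.log (z - x))]
  · ring
  · intro x _
    have h1 : HasDerivAt (fun x : ℝ => z - (x : ℂ)) (-1) x := by
      simpa using (Complex.ofRealCLM.hasDerivAt (x := x)).const_sub z
    have h2 := (h1.clog_real (hne x)).fun_neg
    convert h2 using 1
    rw [neg_div, neg_neg]
  · refine Continuous.intervalIntegrable ?_ _ _
    exact continuous_const.div (by fun_prop) fun x => Complex.slitPlane_ne_zero (hne x)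

theorem log_eq_log_neg_add_of_im_pos {w : ℂ} (hw : 0 < w.im) :
    Complex.log w = Complex.log (-w) + Real.pi * Complex.I := by
  rw [Complex.log, Complex.log, norm_neg, Complex.arg_neg_eq_arg_sub_pi_of_im_pos hw]
  push_cast
  ring

theorem log_eq_log_neg_sub_of_im_neg {w : ℂ} (hw : w.im < 0) :
    Complex.log w = Complex.log (-w) - Real.pi * Complex.I := by
  rw [Complex.log, Complex.log, norm_neg, Complex.arg_neg_eq_arg_add_pi_of_im_neg hw]
  push_cast
  ring

/-- Splitting the Cauchy transform into the contribution away from `Ioo p q`, the integral of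
difference quotients over `Ioo p q`, and a logarithmic term. -/
theorem cauchyOfDensity_eq_add {a b p q : ℝ} (hap : a ≤ p) (hpq : p ≤ q) (hqb : q ≤ b)
    {f : ℂ → ℂ} (hint : IntegrableOn (fun x : ℝ => f x) (Ioo a b)) {z : ℂ} (hz : z.im ≠ 0) :
    cauchyOfDensity a b f z = (∫ x in Ioo a b \ Ioo p q, f x / (z - x))
      - (∫ x in Ioo p q, dslope f z x)
      + f z * (Complex.log (z - p) - Complex.log (z - q)) := by
  have hne : ∀ x : ℝ, z - x ≠ 0 := fun x h => hz (by simpa using congrArg Complex.im h)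
  have hcont : Continuous fun x : ℝ => (z - (x : ℂ))⁻¹ :=
    Continuous.inv₀ (by fun_prop) hne
  have hbdd : ∀ x : ℝ, ‖(z - (x : ℂ))⁻¹‖ ≤ |z.im|⁻¹ := fun x => by
    rw [norm_inv]
    have h1 : |z.im| ≤ ‖z - x‖ := by simpa using Complex.abs_im_le_norm (z - x)
    have h2 : 0 < |z.im| := abs_pos.2 hz
    gcongr
  have hI : IntegrableOn (fun x : ℝ => f x / (z - x)) (Ioo a b) := by
    simp only [div_eq_mul_inv]
    exact Integrable.mul_bdd (c := |z.im|⁻¹) hint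
      hcont.aestronglyMeasurable (Filter.Eventually.of_forall hbdd)
  have hsub : Ioo p q ⊆ Ioo a b := Ioo_subset_Ioo hap hqb
  have hI1 : IntegrableOn (fun x : ℝ => f x / (z - x)) (Ioo p q) := hI.mono_set hsub
  have hI2 : IntegrableOn (fun x : ℝ => f z * (1 / (z - x))) (Ioo p q) := by
    simp only [one_div]
    exact ((hcont.const_mul (f z)).continuousOn (s := Icc p q)).integrableOn_Icc.mono_set
      Ioo_subset_Icc_self
  have hds : ∀ x : ℝ, dslope f z x = f z * (1 / (z - x)) - f x / (z - x) := fun x => by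
    have h1 : (x : ℂ) - z ≠ 0 := by rw [← neg_sub]; exact neg_ne_zero.2 (hne x)
    rw [dslope_of_ne _ (sub_ne_zero.1 h1), slope_def_field]
    have h2 := hne x
    field_simp
    ring
  simp only [hds]
  rw [integral_sub hI2 hI1, integral_const_mul, setIntegral_one_div_sub_ofReal hpq hz,
    cauchyOfDensity, ← integral_inter_add_sdiff measurableSet_Ioo hI, inter_eq_self_of_subset_right hsub]
  ring

/-- Near each point of `(a, b)`, the Cauchy transform continues analytically from the upper
half-plane across the real line, with jump `-2πi f`. -/
theorem exists_local_continuation_cauchyOfDensity {a b c : ℝ} (hc : c ∈ Ioo a b) {f : ℂ → ℂ}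
    (hf : AnalyticAt ℂ f c) (hint : IntegrableOn (fun x : ℝ => f x) (Ioo a b)) :
    ∃ r > 0, ∃ H : ℂ → ℂ, DifferentiableOn ℂ H (Metric.ball c r) ∧
      (∀ z ∈ Metric.ball (c : ℂ) r, 0 < z.im → H z = cauchyOfDensity a b f z) ∧
      (∀ z ∈ Metric.ball (c : ℂ) r, z.im < 0 →
        H z = cauchyOfDensity a b f z - 2 * Real.pi * Complex.I * f z) := by
  have hd : ∀ᶠ z in nhds (c : ℂ), DifferentiableAt ℂ f z ∧ ‖deriv f z‖ ≤ ‖deriv f c‖ + 1 := by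
    refine (hf.eventually_analyticAt.mono fun z hz => hz.differentiableAt).and ?_
    exact (hf.deriv.continuousAt.norm.eventually_lt_const (lt_add_one _)).mono fun z hz => hz.le
  obtain ⟨R, hR, hball⟩ := Metric.eventually_nhds_iff_ball.1 hd
  obtain ⟨r, hr, hr'⟩ : ∃ r > 0, r ≤ R ∧ r ≤ c - a ∧ r ≤ b - c :=
    ⟨min R (min (c - a) (b - c)), lt_min hR (lt_min (sub_pos.2 hc.1) (sub_pos.2 hc.2)),
      min_le_left _ _, (min_le_right _ _).trans (min_le_left _ _),
      (min_le_right _ _).trans (min_le_right _ _)⟩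
  obtain ⟨hrR, hra, hrb⟩ := hr'
  have hfd : DifferentiableOn ℂ f (Metric.ball c r) := fun z hz =>
    (hball z (Metric.ball_subset_ball hrR hz)).1.differentiableWithinAt
  have hre : ∀ z ∈ Metric.ball (c : ℂ) r, |z.re - c| < r := fun z hz => by
    rw [Metric.mem_ball, dist_eq_norm] at hz
    exact lt_of_le_of_lt (by simpa using Complex.abs_re_le_norm (z - c)) hz
  refine ⟨r, hr, fun z => (∫ x in Ioo a b \ Ioo (c - r) (c + r), f x / (z - x))
      - (∫ x in Ioo (c - r) (c + r), dslope f z x)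
      + f z * (Complex.log (z - (c - r : ℝ)) - Complex.log (-(z - (c + r : ℝ)))
        - Real.pi * Complex.I), ?_, ?_, ?_⟩
  · refine (DifferentiableOn.sub ?_ ?_).add (hfd.mul ((DifferentiableOn.sub ?_ ?_).sub_const _))
    · intro z hz
      rw [Metric.mem_ball, dist_eq_norm] at hz
      refine (differentiableAt_setIntegral_div_sub (measurableSet_Ioo.diff measurableSet_Ioo)
        (hint.mono_set sdiff_subset) (sub_pos.2 hz) fun x hx => ?_).differentiableWithinAt
      have h1 : r ≤ ‖(c : ℂ) - x‖ := by
        rw [← Complex.ofReal_sub, Complex.norm_real, Real.norm_eq_abs]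
        by_contra! h
        rw [abs_lt] at h
        exact hx.2 ⟨by linarith, by linarith⟩
      have h2 : ‖(c : ℂ) - x‖ ≤ ‖(c : ℂ) - z‖ + ‖z - x‖ := norm_sub_le_norm_sub_add_norm_sub ..
      rw [norm_sub_rev (c : ℂ) z] at h2
      linarith
    · refine differentiableOn_setIntegral_dslope measurableSet_Ioo (by simp) (fun x hx => ?_) hfd
        fun z hz => (hball z (Metric.ball_subset_ball hrR hz)).2
      rw [Metric.mem_ball, dist_eq_norm, ← Complex.ofReal_sub, Complex.norm_real,
        Real.norm_eq_abs, abs_lt]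
      exact ⟨by linarith [hx.1], by linarith [hx.2]⟩
    · refine DifferentiableOn.clog (by fun_prop) fun z hz => Or.inl ?_
      have := (abs_lt.1 (hre z hz)).1
      simp only [Complex.sub_re, Complex.ofReal_re]
      linarith
    · refine DifferentiableOn.clog (by fun_prop) fun z hz => Or.inl ?_
      have := (abs_lt.1 (hre z hz)).2
      simp only [Complex.neg_re, Complex.sub_re, Complex.ofReal_re]
      linarith
  · intro z _ hz
    rw [cauchyOfDensity_eq_add (p := c - r) (q := c + r) (by linarith) (by linarith) (by linarith)
      hint hz.ne', log_eq_log_neg_add_of_im_pos (w := z - (c + r : ℝ)) (by simpa using hz)]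
    ring
  · intro z _ hz
    rw [cauchyOfDensity_eq_add (p := c - r) (q := c + r) (by linarith) (by linarith) (by linarith)
      hint hz.ne, log_eq_log_neg_sub_of_im_neg (w := z - (c + r : ℝ)) (by simpa using hz)]
    ring

theorem differentiableAt_cauchyOfDensity {a b : ℝ} {f : ℂ → ℂ}
    (hint : IntegrableOn (fun x : ℝ => f x) (Ioo a b)) {z : ℂ} (hz : z.im ≠ 0) :
    DifferentiableAt ℂ (cauchyOfDensity a b f) z :=
  differentiableAt_setIntegral_div_sub measurableSet_Ioo hint (abs_pos.2 hz) fun x _ => by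
    simpa using Complex.abs_im_le_norm (z - x)

theorem nhdsWithin_im_pos_neBot (x : ℝ) :
    (nhdsWithin (x : ℂ) {z : ℂ | 0 < z.im}).NeBot := by
  refine mem_closure_iff_nhdsWithin_neBot.1 ?_
  rw [Complex.closure_setOfPred_lt_im]
  simp

/-- If `f` is analytic on an open neighborhood of `(a,b) ∪ {z ∈ ℂ⁻ : arg z ∈ (-θ,0)}`
and integrable on `(a,b)`, then the Cauchy transform of `σ(dx) = f(x)·1_{(a,b)}(x)dx`,
restricted to the upper half-plane, has an analytic continuation `G` to
`ℂ⁺ ∪ (a,b) ∪ {z ∈ ℂ⁻ : arg z ∈ (-θ,0)}` satisfying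
`G(z) = G̃_σ(z) - 2πi f(z)` on the lower sector. -/
theorem cauchy_analytic_continuation (a b θ : ℝ) (ha : 0 < a) (hab : a < b)
    (hθ : 0 < θ) (hθπ : θ ≤ Real.pi)
    (f : ℂ → ℂ) (U : Set ℂ) (hU : IsOpen U)
    (hUsub : (((↑) : ℝ → ℂ) '' Set.Ioo a b) ∪ lowerSector θ ⊆ U)
    (hf : AnalyticOnNhd ℂ f U)
    (hint : IntegrableOn (fun x : ℝ => f (x : ℂ)) (Set.Ioo a b)) :
    ∃ G : ℂ → ℂ,
      AnalyticOnNhd ℂ G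
        ({z : ℂ | 0 < z.im} ∪ (((↑) : ℝ → ℂ) '' Set.Ioo a b) ∪ lowerSector θ) ∧
      (∀ z : ℂ, 0 < z.im → G z = cauchyOfDensity a b f z) ∧
      (∀ z ∈ lowerSector θ,
        G z = cauchyOfDensity a b f z - 2 * Real.pi * Complex.I * f z) := by
  have hUp : IsOpen {z : ℂ | 0 < z.im} := isOpen_lt continuous_const Complex.continuous_im
  have hLow : IsOpen {z : ℂ | z.im < 0} := isOpen_lt Complex.continuous_im continuous_const
  set C := cauchyOfDensity a b f
  set G : ℂ → ℂ := fun z =>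
    if 0 < z.im then C z
    else if z.im < 0 then C z - 2 * Real.pi * Complex.I * f z
    else Filter.limUnder (nhdsWithin z {w : ℂ | 0 < w.im}) C with hG
  have hGup : ∀ z : ℂ, 0 < z.im → G z = C z := fun z hz => if_pos hz
  have hGlow : ∀ z : ℂ, z.im < 0 → G z = C z - 2 * Real.pi * Complex.I * f z := fun z hz => by
    simp only [hG, if_neg hz.not_gt, if_pos hz]
  refine ⟨G, ?_, hGup, fun z hz => hGlow z hz.1⟩
  rintro z ((hz | ⟨c, hc, rfl⟩) | hz)
  · have hCan : AnalyticAt ℂ C z := by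
      refine Complex.analyticAt_iff_eventually_differentiableAt.2 ?_
      filter_upwards [hUp.mem_nhds hz] with w hw
      exact differentiableAt_cauchyOfDensity hint (ne_of_gt hw)
    refine hCan.congr ?_
    filter_upwards [hUp.mem_nhds hz] with w hw using (hGup w hw).symm
  · obtain ⟨r, hr, H, hHd, hHup, hHlow⟩ := exists_local_continuation_cauchyOfDensity hc
      (hf c (hUsub (Or.inl ⟨c, hc, rfl⟩))) hint
    have hball := Metric.ball_mem_nhds (c : ℂ) hr
    refine (hHd.analyticAt hball).congr ?_
    filter_upwards [hball] with w hw
    rcases lt_trichotomy w.im 0 with h | h | h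
    · rw [hHlow w hw h, hGlow w h]
    · have hGw : G w = Filter.limUnder (nhdsWithin w {w : ℂ | 0 < w.im}) C := by
        simp only [hG, h, lt_irrefl, if_false]
      rw [hGw]
      have hne : (nhdsWithin w {w : ℂ | 0 < w.im}).NeBot := by
        have hwre : ((w.re : ℝ) : ℂ) = w := Complex.ext (by simp) (by simp [h])
        rw [← hwre]
        exact nhdsWithin_im_pos_neBot w.re
      have hwn := Metric.isOpen_ball.mem_nhds hw
      refine (Filter.Tendsto.limUnder_eq ?_).symm
      refine ((hHd.differentiableAt hwn).continuousAt.tendsto.mono_left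
        nhdsWithin_le_nhds).congr' ?_
      filter_upwards [nhdsWithin_le_nhds hwn, self_mem_nhdsWithin] with v hv hv' using hHup v hv hv'
    · rw [hHup w hw h, hGup w h]
  · have hCan : AnalyticAt ℂ C z := by
      refine Complex.analyticAt_iff_eventually_differentiableAt.2 ?_
      filter_upwards [hLow.mem_nhds hz.1] with w hw
      exact differentiableAt_cauchyOfDensity hint (ne_of_lt hw)
    refine (hCan.sub ((analyticAt_const (v := 2 * Real.pi * Complex.I)).mul
      (hf z (hUsub (Or.inr hz))))).congr ?_
    filter_upwards [hLow.mem_nhds hz.1] with w hw using (hGlow w hw).symm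
end

section
/- Let 0 < a < b, N ∈ ℕ, α = (α₁,…,α_N) ∈ (0,∞)^N, and l = (l₁,…,l_N) ∈ ℝ^N with l₁ < ⋯ < l_N, and suppose the function f(x) = (√((b−x)(x−a))/x)·Σ_{k=1}^N α_k x^{−l_k} on (a,b) is a probability density. Let X be a random variable with law GPFP(a,b,N,α,l), i.e., the probability measure f(x)·1_{(a,b)}(x)dx. If there exists t ≥ 0 such that t ≤ l₁ and l_N ≤ t + 1, then for every real r ≥ 1 the law of X^r (the pushforward of GPFP(a,b,N,α,l) under x ↦ x^r) belongs to the class UI. -/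
open MeasureTheory Set

/-- The Cauchy transform of a measure on `ℝ`, `G_μ(z) = ∫ (z-x)⁻¹ dμ(x)`. -/
noncomputable def cauchyTransform (μ : Measure ℝ) (z : ℂ) : ℂ :=
  ∫ x : ℝ, (z - (x : ℂ))⁻¹ ∂μ

/-- The class UI: the right inverse of the Cauchy transform, defined on some triangular
domain `Λ_{γ,δ} = {w ∈ ℂ⁻ : γ|Re w| < -Im w, Im w > -δ}`, has a univalent (injective)
analytic continuation `F` to the whole lower half-plane. -/
def IsUI (μ : Measure ℝ) : Prop :=
  ∃ F : ℂ → ℂ,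
    AnalyticOnNhd ℂ F {z : ℂ | z.im < 0} ∧
    Set.InjOn F {z : ℂ | z.im < 0} ∧
    ∃ γ : ℝ, 0 < γ ∧ ∃ δ : ℝ, 0 < δ ∧
      ∀ w : ℂ, γ * |w.re| < -w.im → -δ < w.im →
        0 < (F w).im ∧ cauchyTransform μ (F w) = w

/-- Density of the generalized power distribution with free Poisson term:
`f(x) = (√((b-x)(x-a))/x) · Σ_k α_k x^{-l_k}`. -/
noncomputable def gpfpDensity (a b : ℝ) (N : ℕ) (α l : Fin N → ℝ) (x : ℝ) : ℝ :=
  Real.sqrt ((b - x) * (x - a)) / x * ∑ k : Fin N, α k * x ^ (-(l k))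

/-- The GPFP measure: the measure on `(a,b)` with density `gpfpDensity`. -/
noncomputable def GPFP (a b : ℝ) (N : ℕ) (α l : Fin N → ℝ) : Measure ℝ :=
  MeasureTheory.volume.withDensity
    (fun x => ENNReal.ofReal ((Set.Ioo a b).indicator (gpfpDensity a b N α l) x))

open Filter Topology Metric

/-- Near a critical point an analytic function takes every nearby value at least twice. -/
theorem AnalyticAt.eventually_exists_pair_of_deriv_eq_zero {f : ℂ → ℂ} {c : ℂ}
    (hf : AnalyticAt ℂ f c) (hd : deriv f c = 0) (hne : ¬ ∀ᶠ z in 𝓝 c, f z = f c)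
    {s : Set ℂ} (hs : s ∈ 𝓝 c) :
    ∀ᶠ w in 𝓝 (f c), w ≠ f c → ∃ z ∈ s, ∃ z' ∈ s, z ≠ z' ∧ f z = w ∧ f z' = w := by
  have hfa : AnalyticAt ℂ (fun z => f z - f c) c := hf.sub analyticAt_const
  have hord : analyticOrderAt (fun z => f z - f c) c ≠ ⊤ := by
    rw [Ne, analyticOrderAt_eq_top]
    simpa [sub_eq_zero] using hne
  obtain ⟨k, hk⟩ := ENat.ne_top_iff_exists.1 hord
  obtain ⟨g, hg, hg0, hfg⟩ := (hfa.analyticOrderAt_eq_natCast).1 hk.symm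
  have hk2 : 2 ≤ k := by
    by_contra! hlt
    interval_cases k
    · have := hfg.self_of_nhds
      simp at this
      exact hg0 this.symm
    · have h1 : HasDerivAt (fun z => (z - c) ^ 1 • g z) (g c) c := by
        have := ((hasDerivAt_id c).sub_const c).fun_mul hg.differentiableAt.hasDerivAt
        simpa using this
      have h2 : HasDerivAt (fun z => f z - f c) (g c) c := h1.congr_of_eventuallyEq hfg
      have h3 : HasDerivAt (fun z => f z - f c) (deriv f c) c :=
        hf.differentiableAt.hasDerivAt.sub_const _
      exact hg0 (by rw [h2.unique h3, hd])
  have hk0 : (k : ℂ) ≠ 0 := by exact_mod_cast (by lia : k ≠ 0)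
  obtain ⟨e, he⟩ := IsAlgClosed.exists_pow_nat_eq (g c) (by lia : 0 < k)
  have he0 : e ≠ 0 := by
    rintro rfl
    exact hg0 (by rw [← he, zero_pow (by lia)])
  set u : ℂ → ℂ := fun z => (g z / g c) ^ (1 / (k : ℂ)) with hu
  have hua : AnalyticAt ℂ u c := by
    refine AnalyticAt.cpow (hg.div analyticAt_const hg0) analyticAt_const ?_
    simp [hg0]
  have huc : u c = 1 := by simp [hu, hg0]
  set φ : ℂ → ℂ := fun z => (z - c) * (e * u z) with hφ
  have hφpow : ∀ᶠ z in 𝓝 c, φ z ^ k = f z - f c := by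
    filter_upwards [hfg] with z hz
    rw [hz, hφ]
    simp only [mul_pow, he, hu, smul_eq_mul, one_div]
    rw [Complex.cpow_nat_inv_pow _ (by lia)]
    field_simp
  have hφd : HasStrictDerivAt φ e c := by
    have h1 : AnalyticAt ℂ φ c := by fun_prop
    have h2 : HasDerivAt φ e c := by
      have := ((hasDerivAt_id c).sub_const c).fun_mul
        ((hua.differentiableAt.hasDerivAt).const_mul e)
      simpa [huc] using this
    exact h2.deriv ▸ h1.hasStrictDerivAt
  have hφc : φ c = 0 := by simp [hφ]
  have hopen := hφd.map_nhds_eq he0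
  rw [hφc] at hopen
  have himg : φ '' (s ∩ {z | φ z ^ k = f z - f c}) ∈ 𝓝 (0 : ℂ) := by
    rw [← hopen]; exact image_mem_map (inter_mem hs hφpow)
  obtain ⟨ε, hε, hball⟩ := Metric.mem_nhds_iff.1 himg
  filter_upwards [Metric.ball_mem_nhds (f c) (pow_pos hε k)] with w hw hwne
  obtain ⟨τ, hτ⟩ := IsAlgClosed.exists_pow_nat_eq (w - f c) (by lia : 0 < k)
  have hτ0 : τ ≠ 0 := by
    rintro rfl
    rw [zero_pow (by lia)] at hτ
    exact hwne (sub_eq_zero.1 hτ.symm)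
  have hτε : ‖τ‖ < ε := by
    have : ‖τ‖ ^ k < ε ^ k := by rw [← norm_pow, hτ]; exact mem_ball_iff_norm.1 hw
    exact lt_of_pow_lt_pow_left₀ k hε.le this
  have hω := Complex.isPrimitiveRoot_exp k (by lia)
  set ω := Complex.exp (2 * Real.pi * Complex.I / k)
  have hωn : ‖ω‖ = 1 := hω.norm'_eq_one (by lia)
  obtain ⟨z, ⟨hzs, hz⟩, hzτ⟩ := hball (show τ ∈ ball 0 ε by simpa using hτε)
  obtain ⟨z', ⟨hzs', hz'⟩, hzτ'⟩ := hball (show ω * τ ∈ ball 0 ε by simpa [hωn] using hτε)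
  refine ⟨z, hzs, z', hzs', ?_, ?_, ?_⟩
  · rintro rfl
    rw [hzτ] at hzτ'
    exact hω.ne_one (by lia) (mul_right_cancel₀ hτ0 (by rw [← hzτ', one_mul]))
  · have : φ z ^ k = f z - f c := hz
    rw [hzτ, hτ] at this
    simpa using this.symm
  · have : φ z' ^ k = f z' - f c := hz'
    rw [hzτ', mul_pow, hω.pow_eq_one, one_mul, hτ] at this
    simpa using this.symm

/-- A holomorphic map that is proper over a connected open set `U` and is one-to-one, with
nonvanishing derivative, over a single point of `U` has a holomorphic inverse on `U`. -/
theorem exists_analytic_inverse_of_proper {f : ℂ → ℂ} {L U : Set ℂ} (hL : IsOpen L)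
    (hLc : IsPreconnected L) (hf : DifferentiableOn ℂ f L) (hU : IsOpen U)
    (hUc : IsPreconnected U) (hnc : ¬ ∃ w, ∀ z ∈ L, f z = w)
    (hprop : ∀ 𝒰 : Ultrafilter ℂ, (∀ᶠ z in (𝒰 : Filter ℂ), z ∈ L) → ∀ w ∈ U,
      Tendsto f 𝒰 (𝓝 w) → ∃ z ∈ L, (𝒰 : Filter ℂ) ≤ 𝓝 z)
    (hex : ∃ z ∈ L, f z ∈ U) {w₀ : ℂ} (hw₀ : w₀ ∈ U)
    (hinj : ∀ z ∈ L, ∀ z' ∈ L, f z = w₀ → f z' = w₀ → z = z')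
    (hder : ∀ z ∈ L, f z = w₀ → deriv f z ≠ 0) :
    ∃ F : ℂ → ℂ, AnalyticOnNhd ℂ F U ∧ (∀ w ∈ U, F w ∈ L ∧ f (F w) = w) ∧
      ∀ z ∈ L, f z ∈ U → F (f z) = z := by
  have hfa : AnalyticOnNhd ℂ f L := hf.analyticOnNhd hL
  have hloc : ∀ z ∈ L, ¬ ∀ᶠ y in 𝓝 z, f y = f z := fun z hz h =>
    hnc ⟨f z, fun y hy =>
      hfa.eqOn_of_preconnected_of_eventuallyEq analyticOnNhd_const hLc hz h hy⟩
  have hnhds : ∀ z ∈ L, 𝓝 (f z) ≤ map f (𝓝 z) := fun z hz =>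
    ((hfa z hz).eventually_constant_or_nhds_le_map_nhds).resolve_left (hloc z hz)
  have hcont : ∀ z ∈ L, ContinuousAt f z := fun z hz => (hfa z hz).continuousAt
  -- lifting ultrafilters through `f`
  have hlift : ∀ (𝒱 : Ultrafilter ℂ) (w : ℂ), w ∈ U → (𝒱 : Filter ℂ) ≤ 𝓝 w →
      ∀ σ : ℂ → ℂ, (∀ᶠ v in (𝒱 : Filter ℂ), σ v ∈ L ∧ f (σ v) = v) →
      ∃ z ∈ L, f z = w ∧ Tendsto σ 𝒱 (𝓝 z) := by
    intro 𝒱 w hw h𝒱 σ hσ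
    have ht : Tendsto f (𝒱.map σ) (𝓝 w) := by
      rw [Ultrafilter.coe_map, tendsto_map'_iff]
      exact (tendsto_congr' (hσ.mono fun v hv => hv.2)).2 h𝒱
    obtain ⟨z, hz, hle⟩ := hprop (𝒱.map σ) (hσ.mono fun v hv => hv.1) w hw ht
    exact ⟨z, hz, tendsto_nhds_unique ((hcont z hz).tendsto.mono_left hle) ht, hle⟩
  -- surjectivity
  have hsurj : ∀ w ∈ U, ∃ z ∈ L, f z = w := by
    have hsub : U ⊆ f '' L := by
      refine hUc.subset_of_closure_inter_subset ?_ ?_ ?_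
      · rw [isOpen_iff_mem_nhds]
        rintro _ ⟨z, hz, rfl⟩
        exact hnhds z hz (image_mem_map (hL.mem_nhds hz))
      · obtain ⟨z, hz, hzU⟩ := hex
        exact ⟨f z, hzU, z, hz, rfl⟩
      · rintro w ⟨hwc, hwU⟩
        obtain ⟨𝒱, h𝒱, hle⟩ := mem_closure_iff_ultrafilter.1 hwc
        choose! σ hσ using fun v (hv : v ∈ f '' L) => hv
        obtain ⟨z, hz, hzw, -⟩ := hlift 𝒱 w hwU hle σ (mem_of_superset h𝒱 hσ)
        exact ⟨z, hz, hzw⟩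
    exact hsub
  -- the values taken more than once, with multiplicity
  set B : Set ℂ := {w | (∃ z ∈ L, f z = w ∧ deriv f z = 0) ∨
    ∃ z ∈ L, ∃ z' ∈ L, z ≠ z' ∧ f z = w ∧ f z' = w} with hB
  have hBopen : IsOpen B := by
    rw [isOpen_iff_mem_nhds]
    rintro w (⟨z, hz, rfl, hd⟩ | ⟨z, hz, z', hz', hne, rfl, hw'⟩)
    · filter_upwards [(hfa z hz).eventually_exists_pair_of_deriv_eq_zero hd (hloc z hz)
        (hL.mem_nhds hz)] with v hv
      by_cases hvz : v = f z
      · exact Or.inl ⟨z, hz, hvz.symm, hd⟩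
      · exact Or.inr (hv hvz)
    · obtain ⟨s, s', hs, hs', hdisj⟩ := t2_separation_nhds hne
      have h1 := hnhds z hz (image_mem_map (inter_mem hs (hL.mem_nhds hz)))
      have h2 := hnhds z' hz' (image_mem_map (inter_mem hs' (hL.mem_nhds hz')))
      rw [hw'] at h2
      filter_upwards [h1, h2]
      rintro v ⟨y, ⟨hys, hyL⟩, rfl⟩ ⟨y', ⟨hys', hyL'⟩, hv'⟩
      exact Or.inr ⟨y, hyL, y', hyL', hdisj.ne_of_mem hys hys', rfl, hv'⟩
  have hBempty : ∀ w ∈ U, w ∉ B := by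
    by_contra! hcon
    obtain ⟨w₁, hw₁U, hw₁⟩ := hcon
    have hsub : U ⊆ B := by
      refine hUc.subset_of_closure_inter_subset hBopen ⟨w₁, hw₁U, hw₁⟩ ?_
      rintro w ⟨hwc, hwU⟩
      obtain ⟨𝒱, h𝒱, hle⟩ := mem_closure_iff_ultrafilter.1 hwc
      rcases Ultrafilter.union_mem_iff.1 h𝒱 with hcase | hcase
      · choose! σ hσ using fun v (hv : ∃ z ∈ L, f z = v ∧ deriv f z = 0) => hv
        have hσ' : ∀ᶠ v in (𝒱 : Filter ℂ), σ v ∈ L ∧ f (σ v) = v ∧ deriv f (σ v) = 0 :=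
          mem_of_superset hcase hσ
        obtain ⟨z, hz, hzw, ht⟩ := hlift 𝒱 w hwU hle σ (hσ'.mono fun v hv => ⟨hv.1, hv.2.1⟩)
        refine Or.inl ⟨z, hz, hzw, ?_⟩
        have h1 : Tendsto (fun v => deriv f (σ v)) 𝒱 (𝓝 (deriv f z)) :=
          (hfa z hz).deriv.continuousAt.tendsto.comp ht
        have h2 : Tendsto (fun v => deriv f (σ v)) 𝒱 (𝓝 0) :=
          tendsto_const_nhds.congr' (hσ'.mono fun v hv => hv.2.2.symm)
        exact tendsto_nhds_unique h1 h2
      · choose! σ hσ σ' hσ' hrest using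
          fun v (hv : ∃ z ∈ L, ∃ z' ∈ L, z ≠ z' ∧ f z = v ∧ f z' = v) => hv
        have hev : ∀ᶠ v in (𝒱 : Filter ℂ), ∃ z ∈ L, ∃ z' ∈ L, z ≠ z' ∧ f z = v ∧ f z' = v :=
          hcase
        obtain ⟨z, hz, hzw, ht⟩ := hlift 𝒱 w hwU hle σ
          (hev.mono fun v hv => ⟨hσ v hv, (hrest v hv).2.1⟩)
        obtain ⟨z', hz', hzw', ht'⟩ := hlift 𝒱 w hwU hle σ'
          (hev.mono fun v hv => ⟨hσ' v hv, (hrest v hv).2.2⟩)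
        by_cases hzz : z = z'
        · subst hzz
          refine Or.inl ⟨z, hz, hzw, ?_⟩
          by_contra hd
          have hst : HasStrictDerivAt f (deriv f z) z := (hfa z hz).hasStrictDerivAt
          obtain ⟨s, hs, hinjs⟩ : ∃ s ∈ 𝓝 z, InjOn f s := by
            have := hst.eventually_left_inverse hd
            refine ⟨_, this, ?_⟩
            intro a ha b hb hab
            rw [← (show _ = a from ha), ← (show _ = b from hb), hab]
          obtain ⟨v, hv, h1, h2⟩ := (hev.and ((ht.eventually hs).and (ht'.eventually hs))).exists
          exact (hrest v hv).1 (hinjs h1 h2 ((hrest v hv).2.1.trans (hrest v hv).2.2.symm))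
        · exact Or.inr ⟨z, hz, z', hz', hzz, hzw, hzw'⟩
    rcases hsub hw₀ with ⟨z, hz, hzw, hd⟩ | ⟨z, hz, z', hz', hne, hzw, hzw'⟩
    · exact hder z hz hzw hd
    · exact hne (hinj z hz z' hz' hzw hzw')
  choose! F hFL hFf using hsurj
  have huniq : ∀ z ∈ L, f z ∈ U → F (f z) = z := by
    intro z hz hzU
    by_contra hne
    exact hBempty _ hzU (Or.inr ⟨F (f z), hFL _ hzU, z, hz, hne, hFf _ hzU, rfl⟩)
  refine ⟨F, ?_, fun w hw => ⟨hFL w hw, hFf w hw⟩, huniq⟩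
  refine DifferentiableOn.analyticOnNhd (fun w hw => ?_) hU
  have hd : deriv f (F w) ≠ 0 := fun hd =>
    hBempty w hw (Or.inl ⟨F w, hFL w hw, hFf w hw, hd⟩)
  have hst : HasStrictDerivAt f (deriv f (F w)) (F w) := (hfa _ (hFL w hw)).hasStrictDerivAt
  have hFinv : ∀ᶠ y in 𝓝 (F w), F (f y) = y := by
    filter_upwards [hL.mem_nhds (hFL w hw), (hcont _ (hFL w hw)).preimage_mem_nhds
      ((hFf w hw).symm ▸ hU.mem_nhds hw)] with y hy hyU
    exact huniq y hy hyU
  have := hst.to_local_left_inverse hd hFinv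
  rw [hFf w hw] at this
  exact this.hasDerivAt.differentiableAt.differentiableWithinAt

theorem Complex.log_neg_of_im_neg {w : ℂ} (hw : w.im < 0) :
    Complex.log (-w) = Complex.log w + Real.pi * Complex.I := by
  apply Complex.ext <;> simp [Complex.log_re, Complex.log_im,
    Complex.arg_neg_eq_arg_add_pi_of_im_neg hw]

theorem Complex.log_neg_of_im_pos {w : ℂ} (hw : 0 < w.im) :
    Complex.log (-w) = Complex.log w - Real.pi * Complex.I := by
  apply Complex.ext <;> simp [Complex.log_re, Complex.log_im,
    Complex.arg_neg_eq_arg_sub_pi_of_im_pos hw]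

theorem integral_Ioo_inv_sub {A B : ℝ} (hAB : A ≤ B) {z : ℂ} (hz : z.im ≠ 0) :
    IntegrableOn (fun x : ℝ => (z - x)⁻¹) (Ioo A B) ∧
    ∫ x in Ioo A B, (z - (x : ℂ))⁻¹ = Complex.log (z - A) - Complex.log (z - B) := by
  have hne : ∀ x : ℝ, z - x ≠ 0 := fun x h => hz (by simpa using congrArg Complex.im h)
  have hc : Continuous fun x : ℝ => (z - (x : ℂ))⁻¹ := by
    refine Continuous.inv₀ (by fun_prop) hne
  refine ⟨(hc.integrableOn_Icc).mono_set Ioo_subset_Icc_self, ?_⟩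
  rw [← integral_Ioc_eq_integral_Ioo, ← intervalIntegral.integral_of_le hAB]
  have hder : ∀ x ∈ uIcc A B,
      HasDerivAt (fun x : ℝ => -Complex.log (z - x)) ((z - (x : ℂ))⁻¹) x := by
    intro x _
    have h1 : HasDerivAt (fun x : ℝ => z - (x : ℂ)) (-1) x := by
      simpa using (Complex.ofRealCLM.hasDerivAt (x := x)).const_sub z
    have h2 := (h1.clog_real (Complex.mem_slitPlane_iff.2 (Or.inr (by simpa using hz)))).neg
    rwa [show -(-1 / (z - (x : ℂ))) = (z - (x : ℂ))⁻¹ by ring] at h2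
  rw [intervalIntegral.integral_eq_sub_of_hasDerivAt hder (hc.intervalIntegrable _ _)]
  ring

/-- Differentiability of the averaged difference quotient of a holomorphic function. -/
theorem differentiableOn_integral_dslope {A B : ℝ} {P : ℂ → ℂ} {p : ℝ → ℂ} {Ω : Set ℂ}
    (hΩ : IsOpen Ω) (hP : DifferentiableOn ℂ P Ω) (hp : Continuous p)
    (hmem : ∀ x ∈ Ioo A B, (x : ℂ) ∈ Ω) (hPp : ∀ x ∈ Ioo A B, P x = p x) :
    DifferentiableOn ℂ (fun z => ∫ x in Ioo A B, dslope P (x : ℂ) z) Ω := by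
  intro z₀ hz₀
  refine DifferentiableAt.differentiableWithinAt ?_
  obtain ⟨M, hM⟩ : ∃ M, ∀ x ∈ Icc A B, ‖p x‖ ≤ M :=
    isCompact_Icc.exists_bound_of_continuousOn hp.continuousOn
  obtain ⟨δ, hδ, hball⟩ := Metric.isOpen_iff.1 hΩ z₀ hz₀
  set ρ := δ / 5 with hρdef
  have hρ : 0 < ρ := by positivity
  have hsub : closedBall z₀ (4 * ρ) ⊆ Ω :=
    (closedBall_subset_ball (by rw [hρdef]; linarith)).trans hball
  obtain ⟨M', hM'⟩ : ∃ M', ∀ z ∈ closedBall z₀ (4 * ρ), ‖P z‖ ≤ M' :=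
    (isCompact_closedBall _ _).exists_bound_of_continuousOn (hP.continuousOn.mono hsub)
  have hM'0 : 0 ≤ M' := (norm_nonneg _).trans (hM' z₀ (by simp; positivity))
  have hslope : ∀ x : ℝ, ∀ z : ℂ, z ≠ x → dslope P (x : ℂ) z = (P z - P x) / (z - x) :=
    fun x z h => by rw [dslope_of_ne _ h, slope_def_field]
  have hdiff : ∀ x ∈ Ioo A B, DifferentiableOn ℂ (dslope P (x : ℂ)) Ω := fun x hx =>
    (Complex.differentiableOn_dslope (hΩ.mem_nhds (hmem x hx))).2 hP
  have hfar : ∀ x ∈ Ioo A B, ∀ z ∈ closedBall z₀ (4 * ρ), ρ ≤ ‖z - x‖ →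
      ‖dslope P (x : ℂ) z‖ ≤ (M' + M) / ρ := by
    intro x hx z hz hzx
    rw [hslope x z (by rintro rfl; simp at hzx; linarith), norm_div]
    have h1 : ‖P z - P x‖ ≤ M' + M := (norm_sub_le _ _).trans
      (add_le_add (hM' z hz) (hPp x hx ▸ hM x (Ioo_subset_Icc_self hx)))
    exact div_le_div₀ ((norm_nonneg _).trans h1) h1 hρ hzx
  have hbd : ∀ x ∈ Ioo A B, ∀ z ∈ ball z₀ (2 * ρ), ‖dslope P (x : ℂ) z‖ ≤ (M' + M) / ρ := by
    intro x hx z hz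
    rw [mem_ball_iff_norm] at hz
    by_cases hxz : 3 * ρ ≤ ‖(x : ℂ) - z₀‖
    · refine hfar x hx z (by rw [mem_closedBall_iff_norm]; linarith) ?_
      have := norm_sub_le_norm_sub_add_norm_sub (x : ℂ) z z₀
      rw [norm_sub_rev (x : ℂ) z] at this
      linarith
    · push Not at hxz
      refine Complex.norm_le_of_forall_mem_frontier_norm_le (U := ball z₀ (4 * ρ)) isBounded_ball
        (DifferentiableOn.diffContOnCl ?_) ?_ (subset_closure ?_)
      · rw [closure_ball _ (by positivity)]
        exact (hdiff x hx).mono hsub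
      · intro y hy
        rw [frontier_ball _ (by positivity), mem_sphere_iff_norm] at hy
        refine hfar x hx y (by rw [mem_closedBall_iff_norm]; exact hy.le) ?_
        have := norm_sub_le_norm_sub_add_norm_sub y (x : ℂ) z₀
        linarith
      · rw [mem_ball_iff_norm]; linarith
  set K := (M' + M) / ρ / ρ with hK
  have hderiv : ∀ x ∈ Ioo A B, ∀ z ∈ ball z₀ ρ, ‖deriv (dslope P (x : ℂ)) z‖ ≤ K := by
    intro x hx z hz
    rw [mem_ball_iff_norm] at hz
    have hsub2 : closedBall z ρ ⊆ ball z₀ (2 * ρ) := by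
      intro y hy
      rw [mem_closedBall_iff_norm] at hy
      rw [mem_ball_iff_norm]
      have := norm_sub_le_norm_sub_add_norm_sub y z z₀
      linarith
    refine Complex.norm_deriv_le_of_forall_mem_sphere_norm_le hρ ?_ ?_
    · refine DifferentiableOn.diffContOnCl ?_
      rw [closure_ball _ hρ.ne']
      exact (hdiff x hx).mono (hsub2.trans ((ball_subset_closedBall.trans
        (closedBall_subset_closedBall (by linarith))).trans hsub))
    · exact fun y hy => hbd x hx y (hsub2 (sphere_subset_closedBall hy))
  have hae : ∀ z : ℂ, ∀ᵐ x : ℝ ∂(volume.restrict (Ioo A B)), x ∈ Ioo A B ∧ z ≠ x := by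
    intro z
    have h1 : ∀ᵐ x : ℝ ∂(volume.restrict (Ioo A B)), x ≠ z.re :=
      ae_restrict_of_ae (Measure.ae_ne volume _)
    filter_upwards [ae_restrict_mem measurableSet_Ioo, h1] with x hx hne
    exact ⟨hx, fun h => hne (by rw [h]; simp)⟩
  have hpm : Measurable p := hp.measurable
  have hmeas : ∀ z : ℂ, AEStronglyMeasurable (fun x : ℝ => dslope P (x : ℂ) z)
      (volume.restrict (Ioo A B)) := by
    intro z
    have h1 : Measurable fun x : ℝ => (P z - p x) / (z - x) := by fun_prop
    refine h1.aestronglyMeasurable.congr ?_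
    filter_upwards [hae z] with x hx
    rw [hslope x z hx.2, hPp x hx.1]
  have hmain := hasDerivAt_integral_of_dominated_loc_of_lip (𝕜 := ℂ)
    (μ := volume.restrict (Ioo A B)) (F := fun z (x : ℝ) => dslope P (x : ℂ) z) (x₀ := z₀)
    (s := ball z₀ ρ) (bound := fun _ => K)
    (F' := fun x : ℝ => (deriv P z₀ * (z₀ - x) - (P z₀ - p x) * 1) / (z₀ - x) ^ 2)
    (ball_mem_nhds z₀ hρ) (Eventually.of_forall hmeas) ?_ ?_ ?_ (by simp) ?_
  · exact hmain.2.differentiableAt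
  · refine Integrable.of_bound (hmeas z₀) ((M' + M) / ρ) ?_
    filter_upwards [hae z₀] with x hx
    exact hbd x hx.1 z₀ (mem_ball_self (by positivity))
  · have h1 : Measurable fun x : ℝ =>
        (deriv P z₀ * (z₀ - x) - (P z₀ - p x) * 1) / (z₀ - x) ^ 2 := by fun_prop
    exact h1.aestronglyMeasurable
  · filter_upwards [hae z₀] with x hx
    refine (convex_ball _ _).lipschitzOnWith_of_nnnorm_deriv_le (𝕜 := ℂ) ?_ ?_
    · intro y hy
      refine (hdiff x hx.1).differentiableAt (hΩ.mem_nhds (hsub ?_))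
      exact (ball_subset_closedBall.trans (closedBall_subset_closedBall (by linarith))) hy
    · intro y hy
      rw [← NNReal.coe_le_coe, coe_nnnorm, Real.coe_nnabs]
      exact (hderiv x hx.1 y hy).trans (le_abs_self _)
  · filter_upwards [hae z₀] with x hx
    have h1 : HasDerivAt P (deriv P z₀) z₀ := (hP.differentiableAt (hΩ.mem_nhds hz₀)).hasDerivAt
    have h2 := (h1.sub_const (P x)).fun_div ((hasDerivAt_id z₀).sub_const (x : ℂ))
      (sub_ne_zero.2 hx.2)
    rw [hPp x hx.1] at h2
    refine h2.congr_of_eventuallyEq ?_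
    filter_upwards [isOpen_ne.mem_nhds hx.2] with y hy
    simp [hslope x y hy, hPp x hx.1]

/-- Analytic continuation of a Cauchy transform across the support of its density: the
continuation from the upper half-plane equals the Cauchy transform minus the jump `2πiP` below. -/
theorem exists_continuation_cauchy {A B : ℝ} (hAB : A ≤ B) {P : ℂ → ℂ} {p : ℝ → ℂ} {Ω : Set ℂ}
    (hΩ : IsOpen Ω) (hP : DifferentiableOn ℂ P Ω) (hp : Continuous p)
    (hmem : ∀ x ∈ Ioo A B, (x : ℂ) ∈ Ω) (hPp : ∀ x ∈ Ioo A B, P x = p x)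
    (hΩA : ∀ z ∈ Ω, z - A ∈ Complex.slitPlane) (hΩB : ∀ z ∈ Ω, B - z ∈ Complex.slitPlane) :
    ∃ G : ℂ → ℂ, DifferentiableOn ℂ G Ω ∧
      (∀ z, 0 < z.im → G z = ∫ x in Ioo A B, p x * (z - x)⁻¹) ∧
      (∀ z, z.im < 0 → G z =
        (∫ x in Ioo A B, p x * (z - x)⁻¹) - 2 * Real.pi * Complex.I * P z) := by
  have key : ∀ z : ℂ, z.im ≠ 0 → ∫ x in Ioo A B, dslope P (x : ℂ) z =
      P z * (Complex.log (z - A) - Complex.log (z - B)) - ∫ x in Ioo A B, p x * (z - x)⁻¹ := by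
    intro z hz
    have hne : ∀ x : ℝ, z ≠ x := fun x h => hz (by rw [h]; simp)
    obtain ⟨hint, hval⟩ := integral_Ioo_inv_sub hAB hz
    have hint2 : IntegrableOn (fun x : ℝ => p x * (z - x)⁻¹) (Ioo A B) := by
      have hc : Continuous fun x : ℝ => p x * (z - (x : ℂ))⁻¹ :=
        hp.mul (Continuous.inv₀ (by fun_prop) fun x => sub_ne_zero.2 (hne x))
      exact (hc.integrableOn_Icc).mono_set Ioo_subset_Icc_self
    rw [← hval, ← integral_const_mul, ← integral_sub (hint.const_mul _) hint2]
    refine setIntegral_congr_fun measurableSet_Ioo fun x hx => ?_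
    rw [dslope_of_ne _ (hne x), slope_def_field, hPp x hx]
    ring
  refine ⟨fun z => P z * (Complex.log (z - A) - Complex.log (B - z) - Real.pi * Complex.I) -
    ∫ x in Ioo A B, dslope P (x : ℂ) z, ?_, ?_, ?_⟩
  · refine (hP.mul (DifferentiableOn.sub_const (DifferentiableOn.sub ?_ ?_) _)).sub
      (differentiableOn_integral_dslope hΩ hP hp hmem hPp)
    · exact DifferentiableOn.clog (by fun_prop) hΩA
    · exact DifferentiableOn.clog (by fun_prop) hΩB
  · intro z hz
    have h := Complex.log_neg_of_im_neg (w := B - z) (by simpa using hz)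
    rw [neg_sub] at h
    simp only
    rw [key z hz.ne', h]
    ring
  · intro z hz
    have h := Complex.log_neg_of_im_pos (w := B - z) (by simpa using hz)
    rw [neg_sub] at h
    simp only
    rw [key z hz.ne, h]
    ring

/-- The imaginary part of a Cauchy transform in the upper half-plane is, up to sign, a Poisson
integral, which is continuous up to the real axis. -/
theorem exists_poisson_cauchy {A B : ℝ} {p : ℝ → ℝ} (hp : Continuous p)
    (hsupp : ∀ x ∉ Ioo A B, p x = 0) :
    ∃ W : ℂ → ℝ, Continuous W ∧ (∀ x : ℝ, W x = Real.pi * p x) ∧ (∃ M, ∀ z, W z ≤ M) ∧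
      ∀ z : ℂ, 0 < z.im → (∫ x in Ioo A B, (p x : ℂ) * (z - x)⁻¹).im = -W z := by
  obtain ⟨M, hM⟩ : ∃ M, ∀ x, ‖p x‖ ≤ M := by
    obtain ⟨M, hM⟩ := isCompact_Icc.exists_bound_of_continuousOn (s := Icc A B) hp.continuousOn
    refine ⟨max M 0, fun x => ?_⟩
    by_cases hx : x ∈ Ioo A B
    · exact (hM x (Ioo_subset_Icc_self hx)).trans (le_max_left _ _)
    · simp [hsupp x hx]
  have hbound : ∀ (z : ℂ) (t : ℝ), ‖p (z.re + z.im * t) * (1 + t ^ 2)⁻¹‖ ≤ M * (1 + t ^ 2)⁻¹ := by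
    intro z t
    rw [norm_mul, Real.norm_of_nonneg (by positivity : (0 : ℝ) ≤ (1 + t ^ 2)⁻¹)]
    exact mul_le_mul_of_nonneg_right (hM _) (by positivity)
  have hmeas : ∀ z : ℂ, AEStronglyMeasurable
      (fun t : ℝ => p (z.re + z.im * t) * (1 + t ^ 2)⁻¹) volume := by
    intro z
    refine Measurable.aestronglyMeasurable ?_
    have := hp.measurable
    fun_prop
  have hIb : Integrable (fun t : ℝ => M * (1 + t ^ 2)⁻¹) := integrable_inv_one_add_sq.const_mul M
  refine ⟨fun z => ∫ t : ℝ, p (z.re + z.im * t) * (1 + t ^ 2)⁻¹, ?_, ?_, ⟨M * Real.pi, ?_⟩, ?_⟩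
  · refine continuous_of_dominated hmeas (fun z => Eventually.of_forall (hbound z)) hIb ?_
    exact Eventually.of_forall fun t => by fun_prop
  · intro x
    simp [integral_const_mul, mul_comm]
  · intro z
    refine (le_abs_self _).trans ((norm_integral_le_of_norm_le hIb
      (Eventually.of_forall (hbound z))).trans ?_)
    rw [integral_const_mul, integral_univ_inv_one_add_sq]
  · intro z hz
    have hne : ∀ x : ℝ, z - x ≠ 0 := fun x h => hz.ne' (by simpa using congrArg Complex.im h)
    have hc : Continuous fun x : ℝ => (p x : ℂ) * (z - (x : ℂ))⁻¹ := by
      refine Continuous.mul (by fun_prop) (Continuous.inv₀ (by fun_prop) hne)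
    have hint : IntegrableOn (fun x : ℝ => (p x : ℂ) * (z - x)⁻¹) (Ioo A B) :=
      hc.integrableOn_Icc.mono_set Ioo_subset_Icc_self
    have h1 : (∫ x in Ioo A B, (p x : ℂ) * (z - x)⁻¹).im =
        ∫ x in Ioo A B, ((p x : ℂ) * (z - x)⁻¹).im := by
      have := integral_im (𝕜 := ℂ) hint
      simpa using this.symm
    rw [h1, setIntegral_eq_integral_of_forall_compl_eq_zero (fun x hx => by simp [hsupp x hx]),
      ← integral_neg]
    have h2 := Measure.integral_comp_mul_left (fun x => ((p (z.re + x) : ℂ) *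
      (z - ((z.re + x : ℝ) : ℂ))⁻¹).im) z.im
    rw [integral_add_left_eq_self (fun x => ((p x : ℂ) * (z - (x : ℂ))⁻¹).im) z.re] at h2
    have h3 : ∫ x : ℝ, ((p x : ℂ) * (z - (x : ℂ))⁻¹).im = z.im * ∫ x : ℝ,
        ((p (z.re + z.im * x) : ℂ) * (z - ((z.re + z.im * x : ℝ) : ℂ))⁻¹).im := by
      rw [h2, abs_of_pos (inv_pos.2 hz), smul_eq_mul]
      field_simp
    rw [h3, ← integral_const_mul]
    refine integral_congr_ae (Eventually.of_forall fun t => ?_)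
    have h4 : z - ((z.re + z.im * t : ℝ) : ℂ) = z.im * (Complex.I - t) := by
      apply Complex.ext <;> simp
    have h5 : ((Complex.I - (t : ℂ))⁻¹).im = -(1 + t ^ 2)⁻¹ := by
      rw [Complex.inv_im]
      simp [Complex.normSq_apply]
      ring
    simp only
    rw [h4, mul_inv, ← Complex.ofReal_inv, ← mul_assoc, ← Complex.ofReal_mul,
      Complex.im_ofReal_mul, h5]
    field_simp

theorem Complex.cpow_half_sq (w : ℂ) : (w ^ (1 / 2 : ℂ)) ^ 2 = w := by
  rw [one_div]
  exact_mod_cast Complex.cpow_nat_inv_pow w two_ne_zero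

theorem Complex.cpow_half_polar (w : ℂ) :
    w ^ (1 / 2 : ℂ) = (‖w‖ ^ (1 / 2 : ℝ) : ℝ) * Complex.exp ((w.arg / 2 : ℝ) * Complex.I) := by
  have h := Complex.cpow_ofReal w (1 / 2)
  push_cast at h
  rw [h, Complex.exp_mul_I]
  push_cast
  ring_nf

theorem Complex.continuousOn_cpow_half : ContinuousOn (fun w : ℂ => w ^ (1 / 2 : ℂ))
    {w | 0 ≤ w.im} := by
  intro w hw
  by_cases hs : w ∈ Complex.slitPlane
  · exact (continuousAt_cpow_const hs).continuousWithinAt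
  by_cases h0 : w = 0
  · subst h0
    have h1 := Complex.continuousAt_cpow_const_of_re_pos (z := 0) (w := (1 / 2 : ℂ))
      (Or.inl le_rfl) (by norm_num)
    exact h1.continuousWithinAt
  · rw [Complex.mem_slitPlane_iff, not_or, not_lt, not_not] at hs
    have hre : w.re < 0 := lt_of_le_of_ne hs.1 fun h => h0 (Complex.ext h hs.2)
    have h1 := Complex.continuousWithinAt_log_of_re_neg_of_im_zero hre hs.2
    have h2 : ContinuousWithinAt (fun w : ℂ => Complex.exp (Complex.log w * (1 / 2)))
        {w | 0 ≤ w.im} w := (h1.mul continuousWithinAt_const).cexp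
    refine h2.congr_of_eventuallyEq ?_ (Complex.cpow_def_of_ne_zero h0 _)
    filter_upwards [mem_nhdsWithin_of_mem_nhds (isOpen_ne.mem_nhds h0)] with y hy
    exact Complex.cpow_def_of_ne_zero hy _

theorem Complex.cpow_half_neg {w : ℂ} (hw : 0 < w.im) :
    (-w) ^ (1 / 2 : ℂ) = -Complex.I * w ^ (1 / 2 : ℂ) := by
  have h0 : w ≠ 0 := by rintro rfl; simp at hw
  have hlog : Complex.log (-w) = Complex.log w - Real.pi * Complex.I := by
    apply Complex.ext <;> simp [Complex.log_re, Complex.log_im,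
      Complex.arg_neg_eq_arg_sub_pi_of_im_pos hw]
  rw [Complex.cpow_def_of_ne_zero (neg_ne_zero.2 h0), Complex.cpow_def_of_ne_zero h0, hlog,
    sub_mul, sub_eq_add_neg, Complex.exp_add, mul_comm]
  congr 1
  rw [show -(Real.pi * Complex.I * (1 / 2)) = ((-(Real.pi / 2) : ℝ) : ℂ) * Complex.I by
    push_cast; ring, Complex.exp_mul_I, ← Complex.ofReal_cos, ← Complex.ofReal_sin]
  simp

theorem Complex.ofReal_cpow_half {x : ℝ} (hx : 0 ≤ x) : (x : ℂ) ^ (1 / 2 : ℂ) = (√x : ℝ) := by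
  rw [Real.sqrt_eq_rpow, Complex.ofReal_cpow hx]
  norm_num

/-- The branch `√(b - e^η) √(a - e^η)`, continuous on the strip `-π ≤ Im η ≤ 0`. -/
noncomputable def sqrtProd (a b : ℝ) (η : ℂ) : ℂ :=
  (b - Complex.exp η) ^ (1 / 2 : ℂ) * (a - Complex.exp η) ^ (1 / 2 : ℂ)

theorem sqrtProd_sq (a b : ℝ) (η : ℂ) :
    sqrtProd a b η ^ 2 = (b - Complex.exp η) * (a - Complex.exp η) := by
  rw [sqrtProd, mul_pow, Complex.cpow_half_sq, Complex.cpow_half_sq]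

theorem sqrtProd_mul_exp_im (a b c : ℝ) (η : ℂ) :
    (sqrtProd a b η * Complex.exp (-c * η)).im =
      ‖(b : ℂ) - Complex.exp η‖ ^ (1 / 2 : ℝ) * ‖(a : ℂ) - Complex.exp η‖ ^ (1 / 2 : ℝ) *
        Real.exp (-c * η.re) * Real.sin
        (((b : ℂ) - Complex.exp η).arg / 2 + ((a : ℂ) - Complex.exp η).arg / 2 - c * η.im) := by
  rw [sqrtProd, Complex.cpow_half_polar, Complex.cpow_half_polar]
  set A₁ := ((b : ℂ) - Complex.exp η).arg / 2
  set A₂ := ((a : ℂ) - Complex.exp η).arg / 2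
  have h : Complex.exp (-c * η) =
      (Real.exp (-c * η.re) : ℝ) * Complex.exp (((-c * η.im : ℝ) : ℂ) * Complex.I) := by
    rw [Complex.ofReal_exp, ← Complex.exp_add]
    congr 1
    conv_lhs => rw [← Complex.re_add_im η]
    push_cast
    ring
  rw [h]
  set n₁ := ‖(b : ℂ) - Complex.exp η‖ ^ (1 / 2 : ℝ)
  set n₂ := ‖(a : ℂ) - Complex.exp η‖ ^ (1 / 2 : ℝ)
  have h2 : (n₁ : ℂ) * Complex.exp (A₁ * Complex.I) * (n₂ * Complex.exp (A₂ * Complex.I)) *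
      ((Real.exp (-c * η.re) : ℝ) * Complex.exp (((-c * η.im : ℝ) : ℂ) * Complex.I)) =
      ((n₁ * n₂ * Real.exp (-c * η.re) : ℝ) : ℂ) *
        Complex.exp (((A₁ + A₂ - c * η.im : ℝ) : ℂ) * Complex.I) := by
    have : ((A₁ + A₂ - c * η.im : ℝ) : ℂ) * Complex.I =
        A₁ * Complex.I + A₂ * Complex.I + ((-c * η.im : ℝ) : ℂ) * Complex.I := by
      push_cast; ring
    rw [this, Complex.exp_add, Complex.exp_add]
    push_cast
    ring
  rw [h2, Complex.im_ofReal_mul, Complex.exp_ofReal_mul_I_im]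

theorem arg_sub_exp_mem {b : ℝ} (hb : 0 < b) {ψ : ℝ} (hψ : 0 < ψ) (hψπ : ψ ≤ Real.pi) {η : ℂ}
    (hη : η.im = -ψ) : 0 ≤ ((b : ℂ) - Complex.exp η).arg ∧
      ((b : ℂ) - Complex.exp η).arg ≤ Real.pi - ψ := by
  have him : ((b : ℂ) - Complex.exp η).im = Real.exp η.re * Real.sin ψ := by
    simp [Complex.exp_im, hη]
  have hre : ((b : ℂ) - Complex.exp η).re = b - Real.exp η.re * Real.cos ψ := by
    simp [Complex.exp_re, hη]
  set w := (b : ℂ) - Complex.exp η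
  have hsin : 0 ≤ Real.sin ψ := Real.sin_nonneg_of_nonneg_of_le_pi hψ.le hψπ
  have hw0 : 0 ≤ w.im := by rw [him]; positivity
  refine ⟨Complex.arg_nonneg_iff.2 hw0, ?_⟩
  rcases hψπ.eq_or_lt with rfl | hlt
  · have h1 : w.im = 0 := by rw [him]; simp
    have h2 : 0 ≤ w.re := by
      rw [hre, Real.cos_pi]
      have := Real.exp_pos η.re
      linarith
    rw [Complex.arg_eq_zero_iff.2 ⟨h2, h1⟩]
    simp
  · by_contra! hcon
    have hAπ := Complex.arg_le_pi w
    have hw : w ≠ 0 := by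
      intro h
      rw [h, Complex.arg_zero] at hcon
      linarith
    have h1 : 0 < Real.sin (w.arg - (Real.pi - ψ)) :=
      Real.sin_pos_of_pos_of_lt_pi (by linarith) (by linarith)
    have h2 : ‖w‖ * Real.sin (w.arg - (Real.pi - ψ)) = -(b * Real.sin ψ) := by
      rw [Real.sin_sub, Real.cos_pi_sub, Real.sin_pi_sub]
      have e1 := Complex.norm_mul_sin_arg w
      have e2 := Complex.norm_mul_cos_arg w
      rw [him] at e1
      rw [hre] at e2
      linear_combination (-Real.cos ψ) * e1 - Real.sin ψ * e2
    have h3 : 0 < ‖w‖ * Real.sin (w.arg - (Real.pi - ψ)) := mul_pos (norm_pos_iff.2 hw) h1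
    have h4 : 0 ≤ b * Real.sin ψ := by positivity
    linarith

theorem sqrtProd_mul_exp_im_nonpos {a b c ψ : ℝ} (ha : 0 < a) (hb : 0 < b) (hψ : 0 < ψ)
    (hψπ : ψ ≤ Real.pi) (h₁ : Real.pi ≤ c * ψ) (h₂ : c * ψ ≤ Real.pi + ψ) {η : ℂ}
    (hη : η.im = -ψ) : (sqrtProd a b η * Complex.exp (-c * η)).im ≤ 0 := by
  rw [sqrtProd_mul_exp_im]
  refine mul_nonpos_of_nonneg_of_nonpos (by positivity) ?_
  obtain ⟨h3, h4⟩ := arg_sub_exp_mem ha hψ hψπ hη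
  obtain ⟨h5, h6⟩ := arg_sub_exp_mem hb hψ hψπ hη
  rw [hη, ← neg_nonneg, ← Real.sin_sub_pi]
  exact Real.sin_nonneg_of_nonneg_of_le_pi (by linarith) (by linarith)

theorem sqrtProd_mul_exp_im_eq_zero {a b c : ℝ} (ha : 0 < a) (hab : a < b) {η : ℂ}
    (hη : η.im = 0) (hout : η.re ≤ Real.log a ∨ Real.log b ≤ η.re) :
    (sqrtProd a b η * Complex.exp (-c * η)).im = 0 := by
  have hη' : η = (η.re : ℂ) := Complex.ext (by simp) (by simp [hη])
  have he : Complex.exp η = (Real.exp η.re : ℝ) := by rw [Complex.ofReal_exp, ← hη']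
  rw [sqrtProd_mul_exp_im, hη, he, ← Complex.ofReal_sub, ← Complex.ofReal_sub]
  rcases hout with h | h
  · have h1 : Real.exp η.re ≤ a := by rwa [← Real.le_log_iff_exp_le ha]
    rw [Complex.arg_ofReal_of_nonneg (by linarith), Complex.arg_ofReal_of_nonneg (by linarith)]
    simp
  · have h1 : b ≤ Real.exp η.re := by rwa [← Real.log_le_iff_le_exp (ha.trans hab)]
    rcases h1.eq_or_lt with h2 | h2
    · simp [← h2]
    · rw [Complex.arg_ofReal_of_neg (by linarith), Complex.arg_ofReal_of_neg (by linarith)]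
      simp

theorem norm_sqrtProd_mul_exp_le {a b c : ℝ} (ha : 0 < a) (hab : a < b) (η : ℂ) :
    ‖sqrtProd a b η * Complex.exp (-c * η)‖ ≤
      b * Real.exp (-c * η.re) + Real.exp ((1 - c) * η.re) := by
  have h1 : ‖sqrtProd a b η‖ ≤ b + Real.exp η.re := by
    have he : ∀ d : ℝ, 0 < d → d ≤ b → ‖(d : ℂ) - Complex.exp η‖ ≤ b + Real.exp η.re := by
      intro d hd hdb
      refine (norm_sub_le _ _).trans ?_
      rw [Complex.norm_exp, Complex.norm_real, Real.norm_of_nonneg hd.le]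
      linarith
    have h2 : ‖sqrtProd a b η‖ ^ 2 ≤ (b + Real.exp η.re) ^ 2 := by
      rw [← norm_pow, sqrtProd_sq, norm_mul, sq]
      have hb := ha.trans hab
      gcongr
      · exact he b hb le_rfl
      · exact he a ha hab.le
    exact le_of_sq_le_sq h2 (by have := Real.exp_pos η.re; linarith)
  have h3 : ‖Complex.exp (-c * η)‖ = Real.exp (-c * η.re) := by
    rw [Complex.norm_exp]; simp
  rw [norm_mul, h3]
  calc ‖sqrtProd a b η‖ * Real.exp (-c * η.re)
      ≤ (b + Real.exp η.re) * Real.exp (-c * η.re) := by gcongr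
    _ = _ := by
      rw [add_mul, ← Real.exp_add]
      ring_nf

theorem continuousOn_sqrtProd (a b : ℝ) :
    ContinuousOn (sqrtProd a b) {η | -Real.pi ≤ η.im ∧ η.im ≤ 0} := by
  have h : ∀ d : ℝ, ContinuousOn (fun η : ℂ => ((d : ℂ) - Complex.exp η) ^ (1 / 2 : ℂ))
      {η | -Real.pi ≤ η.im ∧ η.im ≤ 0} := by
    intro d
    refine Complex.continuousOn_cpow_half.comp (by fun_prop) fun η hη => ?_
    have h1 : Real.sin η.im ≤ 0 := Real.sin_nonpos_of_nonpos_of_neg_pi_le hη.2 hη.1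
    have h2 : 0 ≤ -(Real.exp η.re * Real.sin η.im) := by
      have := Real.exp_pos η.re
      nlinarith
    simpa [Complex.exp_im] using h2
  exact (h b).mul (h a)

theorem tendsto_cexp_mul_atBot {c : ℝ} (hc : 0 < c) {l : Filter ℂ}
    (hl : Tendsto Complex.re l atBot) : Tendsto (fun η => Complex.exp (c * η)) l (𝓝 0) := by
  rw [tendsto_zero_iff_norm_tendsto_zero]
  simp only [Complex.norm_exp, Complex.re_ofReal_mul]
  exact Real.tendsto_exp_atBot.comp (hl.const_mul_atBot hc)

theorem tendsto_cexp_neg_mul_atTop {c : ℝ} (hc : 0 < c) {l : Filter ℂ}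
    (hl : Tendsto Complex.re l atTop) : Tendsto (fun η => Complex.exp (-c * η)) l (𝓝 0) := by
  rw [tendsto_zero_iff_norm_tendsto_zero]
  have : ∀ η : ℂ, ‖Complex.exp (-c * η)‖ = Real.exp (-(c * η.re)) := fun η => by
    rw [Complex.norm_exp]; simp
  simp only [this]
  exact Real.tendsto_exp_neg_atTop_nhds_zero.comp (hl.const_mul_atTop hc)

theorem tendsto_sqrtProd_atBot {a b : ℝ} (ha : 0 < a) (hab : a < b) {l : Filter ℂ}
    (hl : Tendsto Complex.re l atBot) :
    Tendsto (sqrtProd a b) l (𝓝 ((√b * √a : ℝ) : ℂ)) := by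
  have he : Tendsto Complex.exp l (𝓝 0) := by
    simpa using tendsto_cexp_mul_atBot one_pos hl
  have h : ∀ d : ℝ, 0 < d → Tendsto (fun η : ℂ => ((d : ℂ) - Complex.exp η) ^ (1 / 2 : ℂ)) l
      (𝓝 ((√d : ℝ) : ℂ)) := by
    intro d hd
    rw [← Complex.ofReal_cpow_half hd.le]
    have h1 : Tendsto (fun η : ℂ => (d : ℂ) - Complex.exp η) l (𝓝 d) := by
      simpa using he.const_sub (d : ℂ)
    exact (continuousAt_cpow_const (Complex.ofReal_mem_slitPlane.2 hd)).tendsto.comp h1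
  have := (h b (ha.trans hab)).mul (h a ha)
  rw [Complex.ofReal_mul]
  exact this

theorem tendsto_sqrtProd_mul_exp_im_atTop {a b c : ℝ} (hc : 1 ≤ c) {l : Filter ℂ}
    (hl : Tendsto Complex.re l atTop) :
    Tendsto (fun η => (sqrtProd a b η * Complex.exp (-c * η)).im) l (𝓝 0) := by
  set Q : ℂ → ℂ := fun η => sqrtProd a b η * Complex.exp (-η) with hQ
  have he : Tendsto (fun η => Complex.exp (-η)) l (𝓝 0) := by
    simpa using tendsto_cexp_neg_mul_atTop one_pos hl
  have hQ2 : Tendsto (fun η => Q η ^ 2) l (𝓝 1) := by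
    have h1 : ∀ η, Q η ^ 2 = (b * Complex.exp (-η) - 1) * (a * Complex.exp (-η) - 1) := by
      intro η
      have h2 : Complex.exp η * Complex.exp (-η) = 1 := by rw [← Complex.exp_add]; simp
      simp only [hQ]
      rw [mul_pow, sqrtProd_sq]
      linear_combination (-(a + b) * Complex.exp (-η) + 1 + Complex.exp η * Complex.exp (-η)) * h2
    simp only [h1]
    simpa using ((he.const_mul (b : ℂ)).sub_const 1).mul ((he.const_mul (a : ℂ)).sub_const 1)
  have hnorm : Tendsto (fun η => ‖Q η‖ ^ 2) l (𝓝 1) := by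
    simpa using hQ2.norm
  have him : Tendsto (fun η => (Q η).im) l (𝓝 0) := by
    have h1 : Tendsto (fun η => (‖Q η‖ ^ 2 - (Q η ^ 2).re) / 2) l (𝓝 0) := by
      simpa using (hnorm.sub ((Complex.continuous_re.tendsto _).comp hQ2)).div_const 2
    have h2 : ∀ q : ℂ, (‖q‖ ^ 2 - (q ^ 2).re) / 2 = q.im ^ 2 := by
      intro q
      rw [← Complex.normSq_eq_norm_sq, Complex.normSq_apply, sq q, Complex.mul_re]
      ring
    simp only [h2] at h1
    have h3 := h1.sqrt
    simp only [Real.sqrt_sq_eq_abs, Real.sqrt_zero] at h3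
    exact (tendsto_zero_iff_abs_tendsto_zero _).2 h3
  rcases hc.eq_or_lt with rfl | hc
  · simpa [hQ] using him
  · have hbd : IsBoundedUnder (· ≤ ·) l fun η => ‖Q η‖ := by
      have h1 := hnorm.sqrt
      simp only [Real.sqrt_sq (norm_nonneg _)] at h1
      exact h1.isBoundedUnder_le
    have h2 : Tendsto (fun η => Q η * Complex.exp (-((c - 1 : ℝ) : ℂ) * η)) l (𝓝 0) :=
      isBoundedUnder_le_mul_tendsto_zero hbd (tendsto_cexp_neg_mul_atTop (by linarith) hl)
    have h3 := (Complex.continuous_im.tendsto _).comp h2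
    rw [Complex.zero_im] at h3
    refine h3.congr fun η => ?_
    simp only [Function.comp_apply, hQ]
    rw [mul_assoc, ← Complex.exp_add]
    congr 3
    push_cast
    ring

theorem exists_eq_of_norm_sub_inv_le {G : ℂ → ℂ} (hG : DifferentiableOn ℂ G {z | 0 < z.im})
    {K R : ℝ} (hK : ∀ z : ℂ, 0 < z.im → R ≤ ‖z‖ → ‖G z - z⁻¹‖ ≤ K / ‖z‖ ^ 2) :
    ∃ δ : ℝ, 0 < δ ∧ ∀ w : ℂ, |w.re| < -w.im → -δ < w.im → ∃ z : ℂ, 0 < z.im ∧ G z = w := by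
  have hopen : IsOpen {z : ℂ | 0 < z.im} := isOpen_lt continuous_const Complex.continuous_im
  have hpos : 0 < 25 * |K| + 2 * |R| + 1 := by positivity
  refine ⟨1 / (2 * (25 * |K| + 2 * |R| + 1)), by positivity, fun w hw hwδ => ?_⟩
  have hw0 : 0 < -w.im := (abs_nonneg _).trans_lt hw
  have hwne : w ≠ 0 := by rintro rfl; simp at hw0
  have hwn : 0 < ‖w‖ := norm_pos_iff.2 hwne
  have hwsq : ‖w‖ ^ 2 = w.re ^ 2 + w.im ^ 2 := by
    rw [← Complex.normSq_eq_norm_sq, Complex.normSq_apply]; ring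
  have hre2 : w.re ^ 2 < w.im ^ 2 := by
    rw [← sq_abs w.re, ← neg_sq w.im]
    exact pow_lt_pow_left₀ hw (abs_nonneg _) two_ne_zero
  have hwle : ‖w‖ < 2 * -w.im := by
    refine lt_of_pow_lt_pow_left₀ 2 (by linarith) ?_
    rw [hwsq]
    nlinarith
  set z₀ : ℂ := w⁻¹ with hz₀
  set n := ‖z₀‖ with hn
  have hnw : n = ‖w‖⁻¹ := norm_inv w
  have hnpos : 0 < n := by rw [hnw]; positivity
  have hnbig : 25 * |K| + 2 * |R| + 1 < n := by
    rw [hnw, lt_inv_comm₀ hpos hwn]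
    calc ‖w‖ < 2 * -w.im := hwle
      _ < 2 * (1 / (2 * (25 * |K| + 2 * |R| + 1))) := by linarith
      _ = _ := by field_simp
  have hz₀im : n / 2 < z₀.im := by
    have h1 : z₀.im = -w.im * n ^ 2 := by
      rw [hz₀, Complex.inv_im, Complex.normSq_eq_norm_sq, hnw]
      field_simp
    rw [h1]
    have h2 : ‖w‖ * n = 1 := by rw [hnw]; field_simp
    have h3 : ‖w‖ * n ^ 2 = n := by rw [sq, ← mul_assoc, h2, one_mul]
    have := mul_lt_mul_of_pos_right hwle (pow_pos hnpos 2)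
    linarith
  have hball : closedBall z₀ (n / 4) ⊆ {z | 0 < z.im} := by
    intro z hz
    rw [mem_closedBall, dist_eq_norm] at hz
    have h1 := (Complex.abs_im_le_norm (z - z₀)).trans hz
    rw [Complex.sub_im, abs_le] at h1
    simp only [mem_ofPred_eq]
    linarith
  set ε : ℝ := 1 / (5 * n) - 3 * |K| / n ^ 2 with hε
  have hKabs : ∀ z : ℂ, 0 < z.im → R ≤ ‖z‖ → ‖G z - z⁻¹‖ ≤ |K| / ‖z‖ ^ 2 := fun z h1 h2 =>
    (hK z h1 h2).trans (by gcongr; exact le_abs_self K)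
  have hcen : ‖G z₀ - w‖ ≤ |K| / n ^ 2 := by
    have := hKabs z₀ (by linarith) (by have := le_abs_self R; have := abs_nonneg K; linarith)
    rwa [hz₀, inv_inv] at this
  have hsph : ∀ z ∈ sphere z₀ (n / 4), ε ≤ ‖G z - G z₀‖ := by
    intro z hz
    have hzim := hball (sphere_subset_closedBall hz)
    rw [mem_sphere, dist_eq_norm] at hz
    have hz1 : 3 / 4 * n ≤ ‖z‖ := by
      have := norm_sub_norm_le z₀ (z₀ - z)
      rw [sub_sub_cancel, norm_sub_rev z₀ z, hz, ← hn] at this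
      linarith
    have hz2 : ‖z‖ ≤ 5 / 4 * n := by
      have := norm_le_norm_add_norm_sub' z z₀
      rw [hz, ← hn] at this
      linarith
    have hzpos : 0 < ‖z‖ := by linarith
    have hR : R ≤ ‖z‖ := by
      have := le_abs_self R
      have := abs_nonneg R
      have := abs_nonneg K
      linarith
    have h1 : ‖G z - z⁻¹‖ ≤ 2 * |K| / n ^ 2 := by
      refine (hKabs z hzim hR).trans ?_
      rw [div_le_div_iff₀ (by positivity) (by positivity)]
      have : n ^ 2 ≤ 2 * ‖z‖ ^ 2 := by nlinarith
      nlinarith [abs_nonneg K]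
    have h2 : ‖z⁻¹ - w‖ = n / 4 / (‖z‖ * n) := by
      have : z⁻¹ - w = (z₀ - z) / (z * z₀) := by
        have : z ≠ 0 := norm_pos_iff.1 hzpos
        rw [hz₀]
        field_simp
      rw [this, norm_div, norm_mul, norm_sub_rev, hz]
    have h3 : 1 / (5 * n) ≤ ‖z⁻¹ - w‖ := by
      rw [h2, div_le_div_iff₀ (by positivity) (by positivity)]
      nlinarith
    have h4 : ‖z⁻¹ - w‖ ≤ ‖G z - z⁻¹‖ + ‖G z - G z₀‖ + ‖G z₀ - w‖ := by
      have : z⁻¹ - w = -(G z - z⁻¹) + (G z - G z₀) + (G z₀ - w) := by ring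
      rw [this]
      refine (norm_add₃_le).trans ?_
      rw [norm_neg]
    have h5 : 3 * |K| / n ^ 2 = 2 * |K| / n ^ 2 + |K| / n ^ 2 := by ring
    rw [hε, h5]
    linarith
  have hεK : |K| / n ^ 2 < ε / 2 := by
    have h1 : 5 * |K| / n ^ 2 < 1 / (5 * n) := by
      rw [div_lt_div_iff₀ (by positivity) (by positivity)]
      nlinarith [abs_nonneg R]
    have h2 : 5 * |K| / n ^ 2 = 3 * |K| / n ^ 2 + 2 * (|K| / n ^ 2) := by ring
    rw [hε]
    linarith
  have hεpos : 0 < ε := by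
    have : 0 ≤ |K| / n ^ 2 := by positivity
    linarith
  have hfreq : ∃ᶠ z in 𝓝 z₀, G z ≠ G z₀ := by
    intro hev
    simp only [not_not] at hev
    have hconv : Convex ℝ {z : ℂ | 0 < z.im} := convex_halfSpace_im_gt 0
    have heq := (hG.analyticOnNhd hopen).eqOn_of_preconnected_of_eventuallyEq
      (analyticOnNhd_const (v := G z₀)) hconv.isPreconnected
      (hball (mem_closedBall_self (by positivity))) hev
    have hmem : z₀ + (n / 4 : ℝ) ∈ sphere z₀ (n / 4) := by
      rw [mem_sphere, dist_eq_norm, add_sub_cancel_left, Complex.norm_real,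
        Real.norm_of_nonneg (by positivity)]
    have h1 := hsph _ hmem
    rw [heq (hball (sphere_subset_closedBall hmem)), sub_self, norm_zero] at h1
    linarith
  have hdc : DiffContOnCl ℂ G (ball z₀ (n / 4)) := (hG.mono hball).diffContOnCl_ball subset_rfl
  obtain ⟨z, hz, hzw⟩ := hdc.ball_subset_image_closedBall (by positivity) hsph hfreq
    (show w ∈ ball (G z₀) (ε / 2) by
      rw [mem_ball', dist_eq_norm]
      exact hcen.trans_lt hεK)
  exact ⟨z, hball hz, hzw⟩

theorem Complex.injOn_of_norm_deriv_add_le {H : ℂ → ℂ} {D : Set ℂ} (hDo : IsOpen D)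
    (hD : Convex ℝ D) (hH : DifferentiableOn ℂ H D) {q c : ℝ} (hcq : c < q)
    (hb : ∀ z ∈ D, ‖deriv H z + q‖ ≤ c) : InjOn H D := by
  intro x hx y hy hxy
  have hd : ∀ z ∈ D, HasDerivWithinAt (fun z => H z + q * z) (deriv H z + q) D z := by
    intro z hz
    have h1 := (hH.differentiableAt (hDo.mem_nhds hz)).hasDerivAt
    have h2 : HasDerivAt (fun z : ℂ => (q : ℂ) * z) q z := by
      simpa using (hasDerivAt_id z).const_mul (q : ℂ)
    exact (h1.add h2).hasDerivWithinAt
  have h := hD.norm_image_sub_le_of_norm_hasDerivWithin_le hd hb hy hx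
  have h1 : H x + q * x - (H y + q * y) = q * (x - y) := by rw [hxy]; ring
  rw [h1, norm_mul, Complex.norm_real] at h
  by_contra hne
  have h2 : 0 < ‖x - y‖ := norm_pos_iff.2 (sub_ne_zero.2 hne)
  have h3 : q ≤ ‖q‖ := le_abs_self q
  nlinarith

theorem exp_arg_mem {k u : ℂ} {c : ℝ} (hk : ‖k - 1‖ ≤ 1 / 8) (hc : 0 < c)
    (hu : Complex.exp u * k = c * Complex.I) (h0 : 0 < u.im) (h1 : u.im < 2 * Real.pi) :
    Real.pi / 6 < u.im ∧ u.im < 5 * Real.pi / 6 := by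
  have hkre : 7 / 8 ≤ k.re ∧ k.re ≤ 9 / 8 := by
    have := (Complex.abs_re_le_norm (k - 1)).trans hk
    rw [Complex.sub_re, Complex.one_re, abs_le] at this
    constructor <;> linarith
  have hkim : -(1 / 8) ≤ k.im ∧ k.im ≤ 1 / 8 := by
    have := (Complex.abs_im_le_norm (k - 1)).trans hk
    rwa [Complex.sub_im, Complex.one_im, sub_zero, abs_le] at this
  set e := Real.exp u.re
  have he : 0 < e := Real.exp_pos _
  have hre := congrArg Complex.re hu
  have him := congrArg Complex.im hu
  simp only [Complex.mul_re, Complex.mul_im, Complex.exp_re, Complex.exp_im, Complex.ofReal_re,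
    Complex.ofReal_im, Complex.I_re, Complex.I_im] at hre him
  set s := Real.sin u.im with hs
  set d := Real.cos u.im with hd
  have hsd : s ^ 2 + d ^ 2 = 1 := Real.sin_sq_add_cos_sq _
  have hre' : d * k.re = s * k.im := by
    have : e * (d * k.re - s * k.im) = 0 := by linarith
    rcases mul_eq_zero.1 this with h | h
    · exact absurd h he.ne'
    · linarith
  have hspos : 0 < s := by
    have h2 : e * (d * k.im + s * k.re) = c := by linarith
    have h3 : 0 < d * k.im + s * k.re := by
      by_contra! h
      nlinarith
    have h4 : (d * k.im + s * k.re) * k.re = s * (k.im ^ 2 + k.re ^ 2) := by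
      linear_combination k.im * hre'
    have h5 : 0 < s * (k.im ^ 2 + k.re ^ 2) := by
      rw [← h4]; exact mul_pos h3 (by linarith)
    exact pos_of_mul_pos_left h5 (by positivity)
  have hs2 : 1 / 2 < s := by
    have h2 : d ^ 2 * (7 / 8) ^ 2 ≤ s ^ 2 * (1 / 8) ^ 2 := by
      have h3 : d ^ 2 * k.re ^ 2 = s ^ 2 * k.im ^ 2 := by
        rw [← mul_pow, hre', mul_pow]
      have h4 : (7 / 8 : ℝ) ^ 2 ≤ k.re ^ 2 := by nlinarith
      have h5 : k.im ^ 2 ≤ (1 / 8 : ℝ) ^ 2 := by nlinarith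
      nlinarith [sq_nonneg d, sq_nonneg s]
    nlinarith
  have hpi := Real.pi_pos
  have hlt : u.im < Real.pi := by
    by_contra! h
    have := Real.sin_nonpos_of_nonpos_of_neg_pi_le (x := u.im - 2 * Real.pi)
      (by linarith) (by linarith)
    rw [Real.sin_sub_two_pi] at this
    linarith
  constructor
  · by_contra! h
    have := Real.sin_le_sin_of_le_of_le_pi_div_two (x := u.im) (y := Real.pi / 6)
      (by linarith) (by linarith) h
    rw [Real.sin_pi_div_six] at this
    linarith
  · by_contra! h
    have := Real.sin_le_sin_of_le_of_le_pi_div_two (x := Real.pi - u.im) (y := Real.pi / 6)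
      (by linarith) (by linarith) (by linarith)
    rw [Real.sin_pi_div_six, Real.sin_pi_sub] at this
    linarith

theorem exists_unique_exp_mul_eq {q ψ C₀ : ℝ} (hq : 0 < q) (hC₀ : 0 < C₀)
    (h₁ : Real.pi ≤ q * ψ) (h₂ : q * ψ ≤ 2 * Real.pi) {g : ℂ → ℂ} {V : Set ℂ}
    (hV : V = {η : ℂ | -ψ < η.im ∧ η.im < 0}) (hg : DifferentiableOn ℂ g V)
    (hlim : Tendsto g (comap Complex.re atBot ⊓ 𝓟 V) (𝓝 (-C₀ : ℂ))) :
    ∃ R : ℝ, ∀ M : ℝ, 0 < M → ∀ η ∈ V, η.re < R → Complex.exp (-q * η) * g η = -Complex.I * M →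
      deriv (fun η => Complex.exp (-q * η) * g η) η ≠ 0 ∧
      ∀ η' ∈ V, η'.re < R → Complex.exp (-q * η') * g η' = -Complex.I * M → η = η' := by
  have hVo : IsOpen V := by
    rw [hV]
    exact (isOpen_lt continuous_const Complex.continuous_im).inter
      (isOpen_lt Complex.continuous_im continuous_const)
  have hCne : (C₀ : ℂ) ≠ 0 := Complex.ofReal_ne_zero.2 hC₀.ne'
  set k : ℂ → ℂ := fun η => -g η / C₀ with hk
  have hgk : ∀ η, g η = -C₀ * k η := fun η => by simp only [hk]; field_simp
  have hkd : DifferentiableOn ℂ k V := hg.neg.div_const _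
  have hklim : Tendsto k (comap Complex.re atBot ⊓ 𝓟 V) (𝓝 1) := by
    have := hlim.neg.div_const (C₀ : ℂ)
    rwa [neg_neg, div_self hCne] at this
  clear_value k
  obtain ⟨R₁, hR₁⟩ : ∃ R₁ : ℝ, ∀ η ∈ V, η.re < R₁ → ‖k η - 1‖ ≤ 1 / 8 := by
    have h := hklim.eventually (closedBall_mem_nhds (1 : ℂ) (by norm_num : (0 : ℝ) < 1 / 8))
    rw [eventually_inf_principal, eventually_comap] at h
    obtain ⟨R₁, hR₁⟩ := eventually_atBot.1 h
    refine ⟨R₁, fun η hη hlt => ?_⟩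
    have := hR₁ η.re hlt.le η rfl hη
    rwa [← dist_eq_norm]
  set ρ : ℝ := 1 / (2 * q) with hρ
  have hρpos : 0 < ρ := by positivity
  have hqρ : q * ρ = 1 / 2 := by rw [hρ]; field_simp
  set D : Set ℂ := {η | η.re < R₁ - ρ ∧ -(5 * Real.pi / 6) / q < η.im ∧ η.im < -(Real.pi / 6) / q}
  have hDo : IsOpen D := (isOpen_lt Complex.continuous_re continuous_const).inter
    ((isOpen_lt continuous_const Complex.continuous_im).inter
      (isOpen_lt Complex.continuous_im continuous_const))
  have hDc : Convex ℝ D := (convex_halfSpace_re_lt _).inter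
    ((convex_halfSpace_im_gt _).inter (convex_halfSpace_im_lt _))
  have hpi3 := Real.pi_gt_three
  have hDball : ∀ η ∈ D, closedBall η ρ ⊆ V ∩ {η | η.re < R₁} := by
    rintro η ⟨h1, h2, h3⟩ z hz
    rw [mem_closedBall, dist_eq_norm] at hz
    have hr := (Complex.abs_re_le_norm (z - η)).trans hz
    have hi := (Complex.abs_im_le_norm (z - η)).trans hz
    rw [Complex.sub_re, abs_le] at hr
    rw [Complex.sub_im, abs_le] at hi
    rw [div_lt_iff₀ hq] at h2
    rw [lt_div_iff₀ hq] at h3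
    refine ⟨?_, by simp only [mem_ofPred_eq]; linarith⟩
    rw [hV]
    constructor
    · by_contra! h
      have : z.im * q ≤ -ψ * q := by gcongr
      nlinarith
    · by_contra! h
      nlinarith
  have hDV : D ⊆ V := fun η hη => (hDball η hη (mem_closedBall_self hρpos.le)).1
  have hkD : ∀ η ∈ D, ‖k η - 1‖ ≤ 1 / 8 := fun η hη =>
    hR₁ η (hDV hη) (hDball η hη (mem_closedBall_self hρpos.le)).2
  have hkder : ∀ η ∈ D, ‖deriv k η‖ ≤ q / 4 := by
    intro η hη
    have h1 := Complex.norm_deriv_le_of_forall_mem_sphere_norm_le (f := fun z => k z - 1) hρpos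
      (C := 1 / 8) (((hkd.mono fun z hz => (hDball η hη hz).1).sub_const 1).diffContOnCl_ball
        subset_rfl)
      (fun z hz => hR₁ z (hDball η hη (sphere_subset_closedBall hz)).1
        (hDball η hη (sphere_subset_closedBall hz)).2)
    rw [deriv_sub_const] at h1
    refine h1.trans (le_of_eq ?_)
    rw [hρ]
    field_simp
    norm_num
  have hknorm : ∀ η ∈ D, 7 / 8 ≤ ‖k η‖ := by
    intro η hη
    have := norm_sub_norm_le (1 : ℂ) (1 - k η)
    rw [sub_sub_cancel, norm_one, norm_sub_rev] at this
    have := hkD η hη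
    linarith
  have hkre : ∀ η ∈ D, 0 < (k η).re := by
    intro η hη
    have := (Complex.abs_re_le_norm (k η - 1)).trans (hkD η hη)
    rw [Complex.sub_re, Complex.one_re, abs_le] at this
    linarith
  have hkat : ∀ η ∈ D, HasDerivAt k (deriv k η) η := fun η hη =>
    (hkd.differentiableAt (hVo.mem_nhds (hDV hη))).hasDerivAt
  have hHd : ∀ η ∈ D, HasDerivAt (fun η => -q * η + Complex.log (k η))
      (-q + deriv k η / k η) η := by
    intro η hη
    have h1 : HasDerivAt (fun η : ℂ => -(q : ℂ) * η) (-q) η := by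
      simpa using (hasDerivAt_id η).const_mul (-(q : ℂ))
    exact h1.add ((hkat η hη).clog (Or.inl (hkre η hη)))
  have hinj : InjOn (fun η => -q * η + Complex.log (k η)) D := by
    refine Complex.injOn_of_norm_deriv_add_le hDo hDc
      (fun η hη => (hHd η hη).differentiableAt.differentiableWithinAt) (q := q) (c := q / 2)
      (by linarith) fun η hη => ?_
    rw [(hHd η hη).deriv, neg_add_eq_sub, sub_add_cancel, norm_div, div_le_iff₀
      (by have := hknorm η hη; linarith)]
    have := hknorm η hη
    have := hkder η hη
    nlinarith
  have hmem : ∀ M : ℝ, 0 < M → ∀ η ∈ V, η.re < R₁ - ρ →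
      Complex.exp (-q * η) * g η = -Complex.I * M → η ∈ D := by
    intro M hM η hη hlt heq
    have h1 : Complex.exp (-q * η) * k η = (M / C₀ : ℝ) * Complex.I := by
      rw [hgk] at heq
      rw [Complex.ofReal_div, div_mul_eq_mul_div, eq_div_iff hCne]
      linear_combination -heq
    have hη' := hη
    rw [hV] at hη'
    have him : (-(q : ℂ) * η).im = -q * η.im := by simp
    have h2 := exp_arg_mem (hR₁ η hη (by linarith)) (by positivity) h1
      (by rw [him]; nlinarith [hη'.2]) (by rw [him]; nlinarith [hη'.1])
    rw [him] at h2
    refine ⟨hlt, ?_, ?_⟩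
    · rw [div_lt_iff₀ hq]; linarith
    · rw [lt_div_iff₀ hq]; linarith
  refine ⟨R₁ - ρ, fun M hM η hη hlt heq => ?_⟩
  have hηD := hmem M hM η hη hlt heq
  constructor
  · have h1 : HasDerivAt (fun η => Complex.exp (-q * η) * g η)
        (Complex.exp (-q * η) * (-q) * g η + Complex.exp (-q * η) * deriv g η) η := by
      have h2 : HasDerivAt (fun η : ℂ => -(q : ℂ) * η) (-q) η := by
        simpa using (hasDerivAt_id η).const_mul (-(q : ℂ))
      exact h2.cexp.mul (hg.differentiableAt (hVo.mem_nhds hη)).hasDerivAt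
    have h3 : deriv g η = -C₀ * deriv k η := by
      rw [funext hgk]
      exact ((hkat η hηD).const_mul (-(C₀ : ℂ))).deriv
    rw [h1.deriv, h3, hgk]
    have h4 : Complex.exp (-q * η) * (-q) * (-C₀ * k η) + Complex.exp (-q * η) *
        (-C₀ * deriv k η) = Complex.exp (-q * η) * C₀ * (q * k η - deriv k η) := by ring
    rw [h4]
    refine mul_ne_zero (mul_ne_zero (Complex.exp_ne_zero _) hCne) fun h5 => ?_
    have h6 : ‖(q : ℂ) * k η‖ = ‖deriv k η‖ := by rw [sub_eq_zero.1 h5]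
    rw [norm_mul, Complex.norm_real, Real.norm_of_nonneg hq.le] at h6
    have := hknorm η hηD
    have := hkder η hηD
    nlinarith
  · intro η' hη' hlt' heq'
    have hηD' := hmem M hM η' hη' hlt' heq'
    refine hinj hηD hηD' ?_
    have hexp : ∀ z ∈ D, Complex.exp (-q * z + Complex.log (k z)) =
        Complex.exp (-q * z) * k z := by
      intro z hz
      rw [Complex.exp_add, Complex.exp_log]
      intro h0
      have := hkre z hz
      rw [h0] at this
      simp at this
    have h1 : Complex.exp (-q * η + Complex.log (k η)) =
        Complex.exp (-q * η' + Complex.log (k η')) := by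
      rw [hexp η hηD, hexp η' hηD']
      rw [hgk] at heq heq'
      have : (C₀ : ℂ) * (Complex.exp (-q * η) * k η) = C₀ * (Complex.exp (-q * η') * k η') := by
        linear_combination heq' - heq
      exact mul_left_cancel₀ hCne this
    obtain ⟨n, hn⟩ := Complex.exp_eq_exp_iff_exists_int.1 h1
    have him : ∀ z ∈ D, Real.pi / 6 - Real.pi / 2 < (-q * z + Complex.log (k z)).im ∧
        (-q * z + Complex.log (k z)).im < 5 * Real.pi / 6 + Real.pi / 2 := by
      intro z hz
      have h2 := abs_lt.1 (Complex.abs_arg_lt_pi_div_two_iff.2 (Or.inl (hkre z hz)))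
      have h3 : (-q * z + Complex.log (k z)).im = -q * z.im + (k z).arg := by
        simp [Complex.log_im]
      have h4 := (div_lt_iff₀ hq).1 hz.2.1
      have h5 := (lt_div_iff₀ hq).1 hz.2.2
      rw [h3]
      constructor <;> linarith
    have h2 := him η hηD
    have h3 := him η' hηD'
    have h4 : (-q * η + Complex.log (k η)).im =
        (-q * η' + Complex.log (k η')).im + n * (2 * Real.pi) := by
      rw [hn]
      simp
    have hn0 : n = 0 := by
      have h5 : (n : ℝ) < 1 := by
        by_contra! h
        nlinarith
      have h6 : (-1 : ℝ) < n := by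
        by_contra! h
        nlinarith
      have h7 : n < 1 := by exact_mod_cast h5
      have h8 : -1 < n := by exact_mod_cast h6
      omega
    simpa [hn0] using hn

theorem integrableOn_cauchy {A B : ℝ} {p : ℝ → ℝ} (hp : Continuous p) {z : ℂ} (hz : z.im ≠ 0) :
    IntegrableOn (fun x : ℝ => (p x : ℂ) * (z - x)⁻¹) (Ioo A B) := by
  have hne : ∀ x : ℝ, z - x ≠ 0 := fun x h => hz (by rw [sub_eq_zero.1 h, Complex.ofReal_im])
  have hc : Continuous fun x : ℝ => (p x : ℂ) * (z - x)⁻¹ :=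
    (Complex.continuous_ofReal.comp hp).mul
      ((continuous_const.sub Complex.continuous_ofReal).inv₀ hne)
  exact (hc.continuousOn.integrableOn_Icc (a := A) (b := B)).mono_set Ioo_subset_Icc_self

theorem cauchy_im_nonneg {A B : ℝ} {p : ℝ → ℝ} (hp : Continuous p) (hp0 : ∀ x, 0 ≤ p x)
    {z : ℂ} (hz : z.im < 0) : 0 ≤ (∫ x in Ioo A B, (p x : ℂ) * (z - x)⁻¹).im := by
  have h := Complex.imCLM.integral_comp_comm (integrableOn_cauchy (A := A) (B := B) hp hz.ne)
  simp only [Complex.imCLM_apply] at h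
  rw [← h]
  refine integral_nonneg fun x => ?_
  simp only [Complex.im_ofReal_mul, Complex.inv_im, Complex.sub_im, Complex.ofReal_im, sub_zero]
  exact mul_nonneg (hp0 x) (div_nonneg (by linarith) (Complex.normSq_nonneg _))

theorem norm_cauchy_le {A B d : ℝ} {p : ℝ → ℝ} (hp : Continuous p) (hp0 : ∀ x, 0 ≤ p x)
    (hd : 0 < d) {z : ℂ} (hz : ∀ x ∈ Ioo A B, d ≤ ‖z - (x : ℂ)‖) :
    ‖∫ x in Ioo A B, (p x : ℂ) * (z - x)⁻¹‖ ≤ (∫ x in Ioo A B, p x) / d := by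
  have hint : IntegrableOn p (Ioo A B) :=
    (hp.continuousOn.integrableOn_Icc (a := A) (b := B)).mono_set Ioo_subset_Icc_self
  rw [← integral_div]
  refine norm_integral_le_of_norm_le (hint.div_const d) ?_
  filter_upwards [ae_restrict_mem measurableSet_Ioo] with x hx
  rw [norm_mul, norm_inv, Complex.norm_real, Real.norm_of_nonneg (hp0 x), ← div_eq_mul_inv]
  exact div_le_div_of_nonneg_left (hp0 x) hd (hz x hx)

theorem norm_cauchy_sub_inv_le {A B : ℝ} (hA : 0 < A) (hAB : A < B) {p : ℝ → ℝ} (hp : Continuous p)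
    (hp0 : ∀ x, 0 ≤ p x) (hp1 : ∫ x in Ioo A B, p x = 1) {z : ℂ} (hz : z.im ≠ 0)
    (hzB : 2 * B ≤ ‖z‖) :
    ‖(∫ x in Ioo A B, (p x : ℂ) * (z - x)⁻¹) - z⁻¹‖ ≤ 2 * B / ‖z‖ ^ 2 := by
  have hint : IntegrableOn p (Ioo A B) :=
    (hp.continuousOn.integrableOn_Icc (a := A) (b := B)).mono_set Ioo_subset_Icc_self
  have hz0 : z ≠ 0 := by rintro rfl; simp at hz
  have hzn : 0 < ‖z‖ := norm_pos_iff.2 hz0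
  have h1 : z⁻¹ = ∫ x in Ioo A B, (p x : ℂ) * z⁻¹ := by
    rw [integral_mul_const, integral_complex_ofReal, hp1]; simp
  have h2 : 2 * B / ‖z‖ ^ 2 = ∫ x in Ioo A B, p x * (2 * B / ‖z‖ ^ 2) := by
    rw [integral_mul_const, hp1, one_mul]
  rw [h2, h1]
  have hint' : IntegrableOn (fun x => (p x : ℂ) * z⁻¹) (Ioo A B) :=
    (hint.ofReal (𝕜 := ℂ)).mul_const _
  rw [← integral_sub (integrableOn_cauchy hp hz) hint']
  refine norm_integral_le_of_norm_le (hint.mul_const _) ?_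
  filter_upwards [ae_restrict_mem measurableSet_Ioo] with x hx
  rw [← mul_sub, norm_mul, Complex.norm_real, Real.norm_of_nonneg (hp0 x)]
  refine mul_le_mul_of_nonneg_left ?_ (hp0 x)
  have hxn : ‖(x : ℂ)‖ = x := by rw [Complex.norm_real, Real.norm_of_nonneg (hA.trans hx.1).le]
  have hzx : ‖z‖ / 2 ≤ ‖z - x‖ := by
    have := norm_sub_norm_le z (x : ℂ)
    rw [hxn] at this
    linarith [hx.2]
  have hzxne : z - x ≠ 0 := norm_pos_iff.1 (by linarith)
  have h3 : (z - x)⁻¹ - z⁻¹ = x / ((z - x) * z) := by field_simp; ring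
  rw [h3, norm_div, norm_mul, hxn, div_le_div_iff₀ (mul_pos (by linarith) hzn) (by positivity)]
  have h4 : x ≤ B := hx.2.le
  have h5 : 0 ≤ x := (hA.trans hx.1).le
  calc x * ‖z‖ ^ 2 ≤ B * ‖z‖ ^ 2 := by gcongr
    _ = 2 * B * (‖z‖ / 2 * ‖z‖) := by ring
    _ ≤ 2 * B * (‖z - x‖ * ‖z‖) := by
      have : 0 ≤ B := by linarith
      gcongr

/-- The density of the `r`-th power in the coordinate `ξ`, where `y = e^{rξ}`. -/
noncomputable def logDensity (a b : ℝ) (N : ℕ) (α l : Fin N → ℝ) (r ξ : ℝ) : ℝ :=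
  1 / r * √((b - Real.exp ξ) * (Real.exp ξ - a)) * ∑ k, α k * Real.exp (-(l k + r) * ξ)

/-- The density of the `r`-th power of a `GPFP` random variable, extended by zero. -/
noncomputable def powDensity (a b : ℝ) (N : ℕ) (α l : Fin N → ℝ) (r y : ℝ) : ℝ :=
  logDensity a b N α l r (Real.log (max y (a ^ r)) / r)

section
variable {a b : ℝ} {N : ℕ} {α l : Fin N → ℝ} {r : ℝ}

theorem continuous_powDensity (ha : 0 < a) : Continuous (powDensity a b N α l r) := by
  have h1 : Continuous (logDensity a b N α l r) := by unfold logDensity; fun_prop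
  refine h1.comp (Continuous.div_const (Continuous.log (by fun_prop) fun y => ?_) r)
  exact ((Real.rpow_pos_of_pos ha r).trans_le (le_max_right _ _)).ne'

theorem powDensity_nonneg (hα : ∀ k, 0 < α k) (hr : 1 ≤ r) (y : ℝ) :
    0 ≤ powDensity a b N α l r y := by
  unfold powDensity logDensity
  have : 0 ≤ r := by linarith
  refine mul_nonneg (by positivity) (Finset.sum_nonneg fun k _ => ?_)
  have := hα k
  positivity

theorem powDensity_eq_zero (ha : 0 < a) (hab : a < b) (hr : 1 ≤ r) {y : ℝ}
    (hy : y ∉ Ioo (a ^ r) (b ^ r)) : powDensity a b N α l r y = 0 := by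
  have hr0 : 0 < r := by linarith
  have hA := Real.rpow_pos_of_pos ha r
  have hsq : (b - Real.exp (Real.log (max y (a ^ r)) / r)) *
      (Real.exp (Real.log (max y (a ^ r)) / r) - a) ≤ 0 := by
    rcases le_or_gt y (a ^ r) with h | h
    · rw [max_eq_right h, Real.log_rpow ha, mul_div_cancel_left₀ _ hr0.ne', Real.exp_log ha]
      simp
    · have h2 : b ^ r ≤ y := by
        by_contra! h3
        exact hy ⟨h, h3⟩
      have h3 : b ≤ Real.exp (Real.log (max y (a ^ r)) / r) := by
        rw [max_eq_left h.le, ← Real.log_le_iff_le_exp (ha.trans hab), le_div_iff₀ hr0, mul_comm,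
          ← Real.log_rpow (ha.trans hab)]
        exact Real.log_le_log (Real.rpow_pos_of_pos (ha.trans hab) r) h2
      exact mul_nonpos_of_nonpos_of_nonneg (by linarith) (by linarith)
  rw [powDensity, logDensity, Real.sqrt_eq_zero_of_nonpos hsq]
  simp

theorem powDensity_rpow (ha : 0 < a) (hr : 1 ≤ r) {x : ℝ} (hx : x ∈ Ioo a b) :
    |r * x ^ (r - 1)| * powDensity a b N α l r (x ^ r) = gpfpDensity a b N α l x := by
  have hr0 : 0 < r := by linarith
  have hx0 : 0 < x := ha.trans hx.1
  have h1 : a ^ r ≤ x ^ r := Real.rpow_le_rpow ha.le hx.1.le hr0.le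
  rw [powDensity, max_eq_left h1, Real.log_rpow hx0, mul_div_cancel_left₀ _ hr0.ne', logDensity,
    Real.exp_log hx0, gpfpDensity, abs_of_nonneg (by positivity)]
  have h2 : ∀ k, Real.exp (-(l k + r) * Real.log x) = x ^ (-(l k)) * x ^ (-r) := by
    intro k
    rw [← Real.rpow_add hx0, Real.rpow_def_of_pos hx0]
    ring_nf
  have h3 : x ^ (r - 1) * x ^ (-r) = x⁻¹ := by
    rw [← Real.rpow_add hx0, ← Real.rpow_neg_one]
    ring_nf
  simp only [h2, ← mul_assoc]
  rw [← Finset.sum_mul]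
  field_simp at h3 ⊢
  rw [h3, one_mul, mul_comm]

theorem integral_map_rpow_GPFP (ha : 0 < a) (hab : a < b) (hα : ∀ k, 0 < α k) (hr : 1 ≤ r)
    {F : ℝ → ℂ} (hF : Continuous F) :
    ∫ y, F y ∂(Measure.map (fun x : ℝ => x ^ r) (GPFP a b N α l)) =
      ∫ y in Ioo (a ^ r) (b ^ r), (powDensity a b N α l r y : ℂ) * F y := by
  have hr0 : 0 < r := by linarith
  have hb : 0 < b := ha.trans hab
  have hcont : Continuous fun x : ℝ => x ^ r := Real.continuous_rpow_const hr0.le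
  rw [integral_map hcont.measurable.aemeasurable hF.aestronglyMeasurable, GPFP]
  have hd0 : ∀ x ∈ Ioo a b, 0 ≤ gpfpDensity a b N α l x := by
    intro x hx
    rw [← powDensity_rpow ha hr hx]
    exact mul_nonneg (abs_nonneg _) (powDensity_nonneg hα hr _)
  have hdm : Measurable ((Ioo a b).indicator (gpfpDensity a b N α l)) := by
    refine Measurable.indicator ?_ measurableSet_Ioo
    unfold gpfpDensity
    fun_prop
  rw [integral_withDensity_eq_integral_toReal_smul hdm.ennreal_ofReal
    (ae_of_all _ fun _ => ENNReal.ofReal_lt_top)]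
  have h1 : ∀ x, (ENNReal.ofReal ((Ioo a b).indicator (gpfpDensity a b N α l) x)).toReal •
      F (x ^ r) = (Ioo a b).indicator (fun x => gpfpDensity a b N α l x • F (x ^ r)) x := by
    intro x
    by_cases hx : x ∈ Ioo a b
    · rw [indicator_of_mem hx, indicator_of_mem hx, ENNReal.toReal_ofReal (hd0 x hx)]
    · simp [indicator_of_notMem hx]
  simp only [h1]
  rw [integral_indicator measurableSet_Ioo]
  have himg : (fun x : ℝ => x ^ r) '' Ioo a b = Ioo (a ^ r) (b ^ r) := by
    ext y
    constructor
    · rintro ⟨x, hx, rfl⟩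
      exact ⟨Real.rpow_lt_rpow ha.le hx.1 hr0, Real.rpow_lt_rpow (ha.trans hx.1).le hx.2 hr0⟩
    · rintro ⟨h1, h2⟩
      have hy : 0 < y := (Real.rpow_pos_of_pos ha r).trans h1
      refine ⟨y ^ r⁻¹, ⟨?_, ?_⟩, Real.rpow_inv_rpow hy.le hr0.ne'⟩
      · rwa [Real.lt_rpow_inv_iff_of_pos ha.le hy.le hr0]
      · rwa [Real.rpow_inv_lt_iff_of_pos hy.le hb.le hr0]
  have hinj : InjOn (fun x : ℝ => x ^ r) (Ioo a b) := by
    intro x hx y hy hxy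
    exact Real.rpow_left_injOn hr0.ne' (ha.trans hx.1).le (ha.trans hy.1).le hxy
  rw [← himg, integral_image_eq_integral_abs_deriv_smul measurableSet_Ioo
    (f' := fun x => r * x ^ (r - 1)) (fun x hx =>
      (Real.hasDerivAt_rpow_const (Or.inl (ha.trans hx.1).ne')).hasDerivWithinAt) hinj]
  refine setIntegral_congr_fun measurableSet_Ioo fun x hx => ?_
  rw [← powDensity_rpow ha hr hx]
  simp only [Complex.real_smul]
  push_cast
  ring
end

/-- The Cauchy transform of the density of the `r`-th power. -/
noncomputable def powCauchy (a b : ℝ) (N : ℕ) (α l : Fin N → ℝ) (r : ℝ) (z : ℂ) : ℂ :=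
  ∫ y in Ioo (a ^ r) (b ^ r), (powDensity a b N α l r y : ℂ) * (z - y)⁻¹

/-- The jump term of the continuation of the Cauchy transform below the real axis. -/
noncomputable def jumpTerm (a b : ℝ) (N : ℕ) (α l : Fin N → ℝ) (r : ℝ) (η : ℂ) : ℂ :=
  -(2 * Real.pi / r : ℝ) *
    ∑ k, α k * (sqrtProd a b η * Complex.exp (-((l k + r : ℝ) : ℂ) * η))

/-- The domain, in the logarithmic coordinate, of the continuation of the Cauchy transform. -/
def logDomain (a b r ψ : ℝ) : Set ℂ :=
  {η | (-ψ < η.im ∧ η.im < Real.pi / r) ∧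
    (η.im ≠ 0 ∨ (Real.log a < η.re ∧ η.re < Real.log b))}

section
variable {a b : ℝ} {N : ℕ} {α l : Fin N → ℝ} {r ψ : ℝ}

theorem isOpen_logDomain : IsOpen (logDomain a b r ψ) := by
  refine ((isOpen_lt continuous_const Complex.continuous_im).inter
    (isOpen_lt Complex.continuous_im continuous_const)).inter (IsOpen.union
      (isOpen_ne_fun Complex.continuous_im continuous_const)
      ((isOpen_lt continuous_const Complex.continuous_re).inter
        (isOpen_lt Complex.continuous_re continuous_const)))

theorem isPreconnected_logDomain (ha : 0 < a) (hab : a < b) (hr : 0 < r) (hψ : 0 < ψ) :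
    IsPreconnected (logDomain a b r ψ) := by
  have hlog : Real.log a < Real.log b := Real.log_lt_log ha hab
  set c : ℝ := (Real.log a + Real.log b) / 2 with hc
  have hmem : (c : ℂ) ∈ logDomain a b r ψ := by
    refine ⟨⟨by simpa using hψ, by simpa using div_pos Real.pi_pos hr⟩, Or.inr ⟨?_, ?_⟩⟩ <;>
      rw [Complex.ofReal_re] <;> linarith
  have hstar : StarConvex ℝ (c : ℂ) (logDomain a b r ψ) := by
    intro η hη s t hs ht hst
    obtain ⟨⟨h1, h2⟩, h3⟩ := hη
    have him : (s • (c : ℂ) + t • η).im = t * η.im := by simp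
    have hre : (s • (c : ℂ) + t • η).re = s * c + t * η.re := by simp
    have hpr : 0 < Real.pi / r := div_pos Real.pi_pos hr
    refine ⟨⟨?_, ?_⟩, ?_⟩
    · rw [him]
      rcases hs.eq_or_lt with rfl | hs
      · have : t = 1 := by linarith
        rw [this]; linarith
      · nlinarith
    · rw [him]
      rcases hs.eq_or_lt with rfl | hs
      · have : t = 1 := by linarith
        rw [this]; linarith
      · nlinarith
    · rw [him, hre]
      rcases ht.eq_or_lt with rfl | ht
      · right
        have : s = 1 := by linarith
        rw [this]
        constructor <;> linarith
      · rcases h3 with h3 | ⟨h3, h4⟩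
        · exact Or.inl (mul_ne_zero ht.ne' h3)
        · right
          have : s = 1 - t := by linarith
          subst this
          constructor <;> nlinarith
  exact (hstar.isPathConnected hmem).isConnected.isPreconnected

theorem Complex.log_exp_real_mul {r : ℝ} {η : ℂ} (h₁ : -Real.pi < r * η.im)
    (h₂ : r * η.im ≤ Real.pi) : Complex.log (Complex.exp (r * η)) = r * η :=
  Complex.log_exp (by simpa using h₁) (by simpa using h₂)

theorem Complex.exp_real_mul_im (r : ℝ) (η : ℂ) :
    (Complex.exp (r * η)).im = Real.exp (r * η.re) * Real.sin (r * η.im) := by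
  simp [Complex.exp_im]

theorem exists_logDomain_continuation (ha : 0 < a) (hab : a < b)
    (hr : 1 ≤ r) (hψr : r * ψ ≤ Real.pi) :
    ∃ (f : ℂ → ℂ) (W : ℂ → ℝ), Continuous W ∧
      (∀ x : ℝ, W x = Real.pi * powDensity a b N α l r x) ∧ (∃ M, ∀ z, W z ≤ M) ∧
      DifferentiableOn ℂ f (logDomain a b r ψ) ∧
      (∀ η : ℂ, 0 < η.im → η.im < Real.pi / r →
        f η = powCauchy a b N α l r (Complex.exp (r * η))) ∧
      (∀ η ∈ logDomain a b r ψ, 0 ≤ η.im → (f η).im = -W (Complex.exp (r * η))) ∧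
      (∀ η : ℂ, -ψ < η.im → η.im < 0 →
        f η = powCauchy a b N α l r (Complex.exp (r * η)) + jumpTerm a b N α l r η) := by
  have hr0 : 0 < r := by linarith
  have hb : 0 < b := ha.trans hab
  have hA : 0 < a ^ r := Real.rpow_pos_of_pos ha r
  have hAB : a ^ r < b ^ r := Real.rpow_lt_rpow ha.le hab hr0
  have hpi := Real.pi_pos
  set p := powDensity a b N α l r with hp
  have hpc : Continuous p := continuous_powDensity ha
  obtain ⟨W, hWc, hWp, hWb, hWim⟩ := exists_poisson_cauchy (A := a ^ r) (B := b ^ r) hpc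
    fun x hx => powDensity_eq_zero ha hab hr hx
  set Ω : Set ℂ := {z | z.im ≠ 0 ∨ (a ^ r < z.re ∧ z.re < b ^ r)} with hΩdef
  have hΩ : IsOpen Ω := IsOpen.union (isOpen_ne_fun Complex.continuous_im continuous_const)
    ((isOpen_lt continuous_const Complex.continuous_re).inter
      (isOpen_lt Complex.continuous_re continuous_const))
  set Pη : ℂ → ℂ := fun η => 1 / r * ((b - Complex.exp η) ^ (1 / 2 : ℂ) *
    (Complex.exp η - a) ^ (1 / 2 : ℂ)) * ∑ k, α k * Complex.exp (-((l k + r : ℝ) : ℂ) * η) with hPη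
  have hslit : ∀ z ∈ Ω, z ∈ Complex.slitPlane := by
    rintro z (hz | hz)
    · exact Or.inr hz
    · exact Or.inl (hA.trans hz.1)
  have hreal : ∀ z : ℂ, z.im = 0 → a ^ r < z.re → z.re < b ^ r →
      ∃ x : ℝ, a < x ∧ x < b ∧ x ^ r = z.re ∧ Complex.log z / r = (Real.log x : ℝ) := by
    intro z hz h1 h2
    have hzp : 0 < z.re := hA.trans h1
    refine ⟨z.re ^ r⁻¹, ?_, ?_, Real.rpow_inv_rpow hzp.le hr0.ne', ?_⟩
    · rwa [Real.lt_rpow_inv_iff_of_pos ha.le hzp.le hr0]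
    · rwa [Real.rpow_inv_lt_iff_of_pos hzp.le hb.le hr0]
    · have : z = (z.re : ℂ) := Complex.ext (by simp) (by simp [hz])
      rw [this, ← Complex.ofReal_log hzp.le, Complex.ofReal_re, Real.log_rpow hzp]
      push_cast
      field_simp
  have hexpim : ∀ z ∈ Ω, (Complex.exp (Complex.log z / r)).im ≠ 0 ∨
      ∃ x : ℝ, a < x ∧ x < b ∧ Complex.exp (Complex.log z / r) = x := by
    intro z hz
    by_cases him : z.im = 0
    · right
      obtain ⟨h1, h2⟩ := hz.resolve_left (not_not.2 him)
      obtain ⟨x, hx1, hx2, -, hx3⟩ := hreal z him h1 h2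
      exact ⟨x, hx1, hx2, by rw [hx3, ← Complex.ofReal_exp, Real.exp_log (ha.trans hx1)]⟩
    · left
      rw [Complex.exp_im]
      refine mul_ne_zero (Real.exp_pos _).ne' ?_
      rw [Complex.div_ofReal_im, Complex.log_im]
      have h1 : z.arg < Real.pi := Complex.mem_slitPlane_iff_arg.1 (hslit z hz) |>.1 |>
        lt_of_le_of_ne (Complex.arg_le_pi z)
      have h2 := Complex.neg_pi_lt_arg z
      have h0 : z.arg ≠ 0 := fun h => him (Complex.arg_eq_zero_iff.1 h).2
      rcases h0.lt_or_gt with h | h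
      · have h3 : z.arg / r < 0 := div_neg_of_neg_of_pos h hr0
        have h4 : -Real.pi < z.arg / r := by rw [lt_div_iff₀ hr0]; nlinarith
        exact (Real.sin_neg_of_neg_of_neg_pi_lt h3 h4).ne
      · have h3 : 0 < z.arg / r := div_pos h hr0
        have h4 : z.arg / r < Real.pi := by rw [div_lt_iff₀ hr0]; nlinarith
        exact (Real.sin_pos_of_pos_of_lt_pi h3 h4).ne'
  have hP : DifferentiableOn ℂ (fun z => Pη (Complex.log z / r)) Ω := by
    intro z hz
    have hlog : DifferentiableAt ℂ (fun z => Complex.log z / r) z :=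
      (differentiableAt_id.clog (hslit z hz)).div_const _
    have hPd : DifferentiableAt ℂ Pη (Complex.log z / r) := by
      have h1 : (b : ℂ) - Complex.exp (Complex.log z / r) ∈ Complex.slitPlane := by
        rcases hexpim z hz with h | ⟨x, -, hx, h⟩
        · exact Or.inr (by simpa using h)
        · rw [h]
          exact Or.inl (by simpa using hx)
      have h2 : Complex.exp (Complex.log z / r) - a ∈ Complex.slitPlane := by
        rcases hexpim z hz with h | ⟨x, hx, -, h⟩
        · exact Or.inr (by simpa using h)
        · rw [h]
          exact Or.inl (by simpa using hx)
      have h3 : DifferentiableAt ℂ (fun η : ℂ => (b - Complex.exp η) ^ (1 / 2 : ℂ))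
          (Complex.log z / r) := DifferentiableAt.cpow_const (by fun_prop) h1
      have h4 : DifferentiableAt ℂ (fun η : ℂ => (Complex.exp η - a) ^ (1 / 2 : ℂ))
          (Complex.log z / r) := DifferentiableAt.cpow_const (by fun_prop) h2
      have h5 : DifferentiableAt ℂ (fun η : ℂ => ∑ k, α k * Complex.exp
          (-((l k + r : ℝ) : ℂ) * η)) (Complex.log z / r) := by fun_prop
      exact ((h3.mul h4).const_mul _).mul h5
    exact (hPd.comp z hlog).differentiableWithinAt
  have hPp : ∀ x ∈ Ioo (a ^ r) (b ^ r), Pη (Complex.log (x : ℂ) / r) = ((p x : ℝ) : ℂ) := by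
    intro y hy
    obtain ⟨x, hx1, hx2, hx3, hx4⟩ := hreal y (by simp) (by simpa using hy.1) (by simpa using hy.2)
    have hx0 : 0 < x := ha.trans hx1
    rw [Complex.ofReal_re] at hx3
    rw [hx4, hp, powDensity, max_eq_left hy.1.le, ← hx3, Real.log_rpow hx0,
      mul_div_cancel_left₀ _ hr0.ne', logDensity, hPη]
    simp only
    rw [← Complex.ofReal_exp, Real.exp_log hx0, ← Complex.ofReal_sub, ← Complex.ofReal_sub,
      Complex.ofReal_cpow_half (by linarith), Complex.ofReal_cpow_half (by linarith),
      Real.sqrt_mul (by linarith)]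
    push_cast
    rfl
  have hmem : ∀ x ∈ Ioo (a ^ r) (b ^ r), (x : ℂ) ∈ Ω := fun x hx =>
    Or.inr (by simpa using hx)
  have hΩA : ∀ z ∈ Ω, z - (a ^ r : ℝ) ∈ Complex.slitPlane := by
    rintro z (hz | hz)
    · exact Or.inr (by simpa using hz)
    · exact Or.inl (by simpa using hz.1)
  have hΩB : ∀ z ∈ Ω, ((b ^ r : ℝ) : ℂ) - z ∈ Complex.slitPlane := by
    rintro z (hz | hz)
    · exact Or.inr (by simpa using hz)
    · exact Or.inl (by simpa using hz.2)
  obtain ⟨G, hGd, hGup, hGlow⟩ := exists_continuation_cauchy hAB.le hΩ hP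
    (p := fun x => ((p x : ℝ) : ℂ)) (Complex.continuous_ofReal.comp hpc) hmem hPp hΩA hΩB
  have hsin_pos : ∀ η : ℂ, 0 < η.im → η.im < Real.pi / r → 0 < (Complex.exp (r * η)).im := by
    intro η h1 h2
    rw [lt_div_iff₀ hr0] at h2
    rw [Complex.exp_real_mul_im]
    exact mul_pos (Real.exp_pos _) (Real.sin_pos_of_pos_of_lt_pi (by positivity) (by linarith))
  have hsin_neg : ∀ η : ℂ, -ψ < η.im → η.im < 0 → (Complex.exp (r * η)).im < 0 := by
    intro η h1 h2
    rw [Complex.exp_real_mul_im]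
    exact mul_neg_of_pos_of_neg (Real.exp_pos _)
      (Real.sin_neg_of_neg_of_neg_pi_lt (by nlinarith) (by nlinarith))
  have hmaps : MapsTo (fun η : ℂ => Complex.exp (r * η)) (logDomain a b r ψ) Ω := by
    rintro η ⟨⟨h1, h2⟩, h3⟩
    rcases lt_trichotomy η.im 0 with h | h | h
    · exact Or.inl (hsin_neg η h1 h).ne
    · right
      obtain ⟨h4, h5⟩ := h3.resolve_left (not_not.2 h)
      have : (Complex.exp (r * η)).re = Real.exp (r * η.re) := by simp [Complex.exp_re, h]
      simp only
      rw [this, Real.rpow_def_of_pos ha, Real.rpow_def_of_pos hb, Real.exp_lt_exp,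
        Real.exp_lt_exp]
      constructor <;> nlinarith
    · exact Or.inl (hsin_pos η h h2).ne'
  have hGW : ∀ z ∈ Ω, 0 ≤ z.im → (G z).im = -W z := by
    intro z hz hz0
    have ht : Tendsto (fun ε : ℝ => z + ε * Complex.I) (𝓝[>] 0) (𝓝 z) := by
      have : Continuous fun ε : ℝ => z + ε * Complex.I := by fun_prop
      simpa using (this.tendsto 0).mono_left nhdsWithin_le_nhds
    have h1 : Tendsto (fun ε : ℝ => (G (z + ε * Complex.I)).im) (𝓝[>] 0) (𝓝 (G z).im) :=
      (Complex.continuous_im.tendsto _).comp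
        (((hGd.differentiableAt (hΩ.mem_nhds hz)).continuousAt.tendsto).comp ht)
    have h2 : Tendsto (fun ε : ℝ => -W (z + ε * Complex.I)) (𝓝[>] 0) (𝓝 (-W z)) :=
      ((hWc.tendsto z).comp ht).neg
    refine tendsto_nhds_unique (h1.congr' ?_) h2
    filter_upwards [self_mem_nhdsWithin] with ε hε
    have h3 : 0 < (z + ε * Complex.I).im := by
      have : (z + ε * Complex.I).im = z.im + ε := by simp
      rw [this]
      exact add_pos_of_nonneg_of_pos hz0 hε
    rw [hGup _ h3, hWim _ h3]
  refine ⟨fun η => G (Complex.exp (r * η)), W, hWc, hWp, hWb,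
    hGd.comp (by fun_prop) hmaps, ?_, ?_, ?_⟩
  · intro η h1 h2
    exact hGup _ (hsin_pos η h1 h2)
  · intro η hη h0
    refine hGW _ (hmaps hη) ?_
    rcases h0.eq_or_lt with h | h
    · rw [Complex.exp_real_mul_im, ← h]; simp
    · exact (hsin_pos η h hη.1.2).le
  · intro η h1 h2
    have hlog : Complex.log (Complex.exp (r * η)) / r = η := by
      rw [Complex.log_exp_real_mul (by nlinarith) (by nlinarith), mul_div_cancel_left₀]
      exact Complex.ofReal_ne_zero.2 hr0.ne'
    have h3 : 0 < ((a : ℂ) - Complex.exp η).im := by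
      have : Real.sin η.im < 0 := Real.sin_neg_of_neg_of_neg_pi_lt h2 (by nlinarith)
      simp only [Complex.sub_im, Complex.ofReal_im, Complex.exp_im]
      have := Real.exp_pos η.re
      nlinarith
    have h4 : (Complex.exp η - a) ^ (1 / 2 : ℂ) =
        -Complex.I * ((a : ℂ) - Complex.exp η) ^ (1 / 2 : ℂ) := by
      rw [← Complex.cpow_half_neg h3, neg_sub]
    simp only
    rw [hGlow _ (hsin_neg η h1 h2), hlog, powCauchy, sub_eq_add_neg, hPη, jumpTerm, sqrtProd]
    congr 1
    simp only [h4]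
    have h5 : ∀ s : ℂ, ∑ k, (α k : ℂ) * (s * Complex.exp (-((l k + r : ℝ) : ℂ) * η)) =
        s * ∑ k, (α k : ℂ) * Complex.exp (-((l k + r : ℝ) : ℂ) * η) := by
      intro s
      rw [Finset.mul_sum]
      exact Finset.sum_congr rfl fun k _ => by ring
    rw [h5]
    set Q := ∑ k, (α k : ℂ) * Complex.exp (-((l k + r : ℝ) : ℂ) * η)
    push_cast
    linear_combination (2 * Real.pi / r * ((b : ℂ) - Complex.exp η) ^ (1 / 2 : ℂ) *
      ((a : ℂ) - Complex.exp η) ^ (1 / 2 : ℂ) * Q) * Complex.I_sq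
end

theorem Ultrafilter.tendsto_re_or_le_nhds (𝒰 : Ultrafilter ℂ) {c : ℝ}
    (h : ∀ᶠ z in (𝒰 : Filter ℂ), |z.im| ≤ c) :
    Tendsto Complex.re 𝒰 atBot ∨ Tendsto Complex.re 𝒰 atTop ∨ ∃ z, (𝒰 : Filter ℂ) ≤ 𝓝 z := by
  by_cases hb : ∃ n : ℝ, ∀ᶠ z in (𝒰 : Filter ℂ), |z.re| ≤ n
  · obtain ⟨n, hn⟩ := hb
    have hK : IsCompact (Icc (-n) n ×ℂ Icc (-c) c) := isCompact_Icc.reProdIm isCompact_Icc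
    have hmem : ∀ᶠ z in (𝒰 : Filter ℂ), z ∈ Icc (-n) n ×ℂ Icc (-c) c := by
      filter_upwards [h, hn] with z h1 h2
      exact ⟨abs_le.1 h2, abs_le.1 h1⟩
    obtain ⟨z, -, hz⟩ := hK.ultrafilter_le_nhds 𝒰 (le_principal_iff.2 hmem)
    exact Or.inr (Or.inr ⟨z, hz⟩)
  · push Not at hb
    rcases 𝒰.em (fun z => z.re ≤ 0) with h0 | h0
    · left
      rw [Filter.tendsto_atBot]
      intro n
      filter_upwards [h0, hb (-n)] with z h1 h2
      rw [abs_of_nonpos h1] at h2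
      linarith
    · right; left
      rw [Filter.tendsto_atTop]
      intro n
      filter_upwards [h0, hb n] with z h1 h2
      rw [abs_of_pos (not_le.1 h1)] at h2
      exact h2.le

section
variable {a b : ℝ} {N : ℕ} {α l : Fin N → ℝ} {r ψ : ℝ}

theorem jumpTerm_im (η : ℂ) : (jumpTerm a b N α l r η).im = -(2 * Real.pi / r) *
    ∑ k, α k * (sqrtProd a b η * Complex.exp (-((l k + r : ℝ) : ℂ) * η)).im := by
  rw [jumpTerm, ← Complex.ofReal_neg, Complex.im_ofReal_mul, Complex.im_sum]
  simp only [Complex.im_ofReal_mul]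

theorem jumpTerm_im_nonneg (ha : 0 < a) (hab : a < b) (hα : ∀ k, 0 < α k) (hr : 0 < r)
    (hψ : 0 < ψ) (hψπ : ψ ≤ Real.pi) (h₁ : ∀ k, Real.pi ≤ (l k + r) * ψ)
    (h₂ : ∀ k, (l k + r) * ψ ≤ Real.pi + ψ) {η : ℂ} (hη : η.im = -ψ) :
    0 ≤ (jumpTerm a b N α l r η).im := by
  have hpi := Real.pi_pos
  rw [jumpTerm_im, neg_mul, ← mul_neg, ← Finset.sum_neg_distrib]
  refine mul_nonneg (by positivity) (Finset.sum_nonneg fun k _ => ?_)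
  rw [← mul_neg]
  exact mul_nonneg (hα k).le (neg_nonneg.2
    (sqrtProd_mul_exp_im_nonpos ha (ha.trans hab) hψ hψπ (h₁ k) (h₂ k) hη))

theorem jumpTerm_im_eq_zero (ha : 0 < a) (hab : a < b) {η : ℂ} (hη : η.im = 0)
    (hout : η.re ≤ Real.log a ∨ Real.log b ≤ η.re) : (jumpTerm a b N α l r η).im = 0 := by
  rw [jumpTerm_im]
  simp only [sqrtProd_mul_exp_im_eq_zero ha hab hη hout, mul_zero, Finset.sum_const_zero]

theorem tendsto_jumpTerm_im_atTop (hlr : ∀ k, 1 ≤ l k + r) {F : Filter ℂ}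
    (hF : Tendsto Complex.re F atTop) :
    Tendsto (fun η => (jumpTerm a b N α l r η).im) F (𝓝 0) := by
  simp only [jumpTerm_im]
  have h := tendsto_finsetSum (Finset.univ : Finset (Fin N)) fun k _ =>
    (tendsto_sqrtProd_mul_exp_im_atTop (a := a) (b := b) (hlr k) hF).const_mul (α k)
  simpa using h.const_mul (-(2 * Real.pi / r))

theorem continuousOn_jumpTerm :
    ContinuousOn (jumpTerm a b N α l r) {η | -Real.pi ≤ η.im ∧ η.im ≤ 0} := by
  unfold jumpTerm
  refine continuousOn_const.mul (continuousOn_finsetSum _ fun k _ => continuousOn_const.mul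
    ((continuousOn_sqrtProd a b).mul (by fun_prop)))

theorem exists_jumpTerm_im_ge (ha : 0 < a) (hab : a < b) (hα : ∀ k, 0 < α k) (hr : 0 < r)
    (hlr : ∀ k, 1 ≤ l k + r) (R : ℝ) :
    ∃ M : ℝ, ∀ η : ℂ, R ≤ η.re → -M ≤ (jumpTerm a b N α l r η).im := by
  have hpi := Real.pi_pos
  refine ⟨2 * Real.pi / r * ∑ k, α k * (b * Real.exp (-(l k + r) * R) +
    Real.exp ((1 - (l k + r)) * R)), fun η hη => ?_⟩
  rw [jumpTerm_im, neg_mul, neg_le_neg_iff]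
  gcongr with k
  · exact (hα k).le
  · refine (Complex.im_le_norm _).trans ((norm_sqrtProd_mul_exp_le ha hab η).trans ?_)
    have := hlr k
    have hb := ha.trans hab
    gcongr ?_ + Real.exp ?_
    · refine mul_le_mul_of_nonneg_left (Real.exp_le_exp.2 ?_) hb.le
      nlinarith
    · nlinarith

theorem tendsto_exp_mul_jumpTerm (ha : 0 < a) (hab : a < b) (hl : StrictMono l) (n : Fin N)
    (hn : ∀ k, k ≤ n) {F : Filter ℂ} (hF : Tendsto Complex.re F atBot) :
    Tendsto (fun η => Complex.exp (((l n + r : ℝ) : ℂ) * η) * jumpTerm a b N α l r η) F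
      (𝓝 (-((2 * Real.pi / r * (α n * (√b * √a)) : ℝ) : ℂ))) := by
  have hS := tendsto_sqrtProd_atBot ha hab hF
  have hterm : ∀ k, Tendsto (fun η => (α k : ℂ) * (sqrtProd a b η *
      Complex.exp (((l n - l k : ℝ) : ℂ) * η))) F
      (𝓝 (if k = n then ((α n * (√b * √a) : ℝ) : ℂ) else 0)) := by
    intro k
    split_ifs with hk
    · subst hk
      simpa using hS.const_mul (α k : ℂ)
    · have hlt : 0 < l n - l k := sub_pos.2 (hl (lt_of_le_of_ne (hn k) hk))
      have := (hS.mul (tendsto_cexp_mul_atBot hlt hF)).const_mul (α k : ℂ)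
      simpa using this
  have h := (tendsto_finsetSum (Finset.univ : Finset (Fin N)) fun k _ => hterm k).const_mul
    (-(2 * Real.pi / r : ℝ) : ℂ)
  rw [Finset.sum_ite_eq' Finset.univ n, if_pos (Finset.mem_univ n)] at h
  have hval : (-(2 * Real.pi / r : ℝ) : ℂ) * ((α n * (√b * √a) : ℝ) : ℂ) =
      -((2 * Real.pi / r * (α n * (√b * √a)) : ℝ) : ℂ) := by push_cast; ring
  rw [hval] at h
  refine h.congr fun η => ?_
  rw [jumpTerm, mul_left_comm]
  congr 1
  rw [Finset.mul_sum]
  refine Finset.sum_congr rfl fun k _ => ?_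
  have : Complex.exp (((l n - l k : ℝ) : ℂ) * η) = Complex.exp (((l n + r : ℝ) : ℂ) * η) *
      Complex.exp (-((l k + r : ℝ) : ℂ) * η) := by
    rw [← Complex.exp_add]
    congr 1
    push_cast
    ring
  rw [this]
  ring

theorem tendsto_exp_mul_powCauchy (ha : 0 < a) (hα : ∀ k, 0 < α k)
    (hr : 1 ≤ r) {q : ℝ} (hq : 0 < q) {F : Filter ℂ} (hF : Tendsto Complex.re F atBot) :
    Tendsto (fun η => Complex.exp (q * η) * powCauchy a b N α l r (Complex.exp (r * η))) F
      (𝓝 0) := by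
  have hA : 0 < a ^ r := Real.rpow_pos_of_pos ha r
  have hbd : IsBoundedUnder (· ≤ ·) F
      (norm ∘ fun η => powCauchy a b N α l r (Complex.exp (r * η))) := by
    refine isBoundedUnder_of_eventually_le
      (a := (∫ x in Ioo (a ^ r) (b ^ r), powDensity a b N α l r x) / (a ^ r / 2)) ?_
    have h0 := tendsto_cexp_mul_atBot (show 0 < r by linarith) hF
    filter_upwards [h0 (ball_mem_nhds 0 (half_pos hA))] with η hη
    rw [mem_preimage, mem_ball_zero_iff] at hη
    refine norm_cauchy_le (continuous_powDensity ha) (powDensity_nonneg hα hr) (half_pos hA)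
      fun x hx => ?_
    have h1 := norm_sub_norm_le (x : ℂ) (Complex.exp (r * η))
    rw [Complex.norm_real, Real.norm_of_nonneg (hA.trans hx.1).le, norm_sub_rev] at h1
    linarith [hx.1]
  have := isBoundedUnder_le_mul_tendsto_zero hbd (tendsto_cexp_mul_atBot hq hF)
  exact this.congr fun η => mul_comm _ _

theorem tendsto_powCauchy_atTop (ha : 0 < a) (hα : ∀ k, 0 < α k) (hr : 1 ≤ r)
    {F : Filter ℂ} (hF : Tendsto Complex.re F atTop) :
    Tendsto (fun η => powCauchy a b N α l r (Complex.exp (r * η))) F (𝓝 0) := by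
  have hA : 0 < a ^ r := Real.rpow_pos_of_pos ha r
  have hnorm : Tendsto (fun η : ℂ => ‖Complex.exp (r * η)‖) F atTop := by
    simp only [Complex.norm_exp, Complex.re_ofReal_mul]
    exact Real.tendsto_exp_atTop.comp (hF.const_mul_atTop (by linarith))
  have hsub : Tendsto (fun η : ℂ => ‖Complex.exp (r * η)‖ - b ^ r) F atTop :=
    tendsto_atTop_add_const_right _ _ hnorm
  refine squeeze_zero_norm' ?_ ((tendsto_const_nhds (x :=
    ∫ x in Ioo (a ^ r) (b ^ r), powDensity a b N α l r x)).div_atTop hsub)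
  filter_upwards [hsub.eventually_gt_atTop 0] with η hη
  refine norm_cauchy_le (continuous_powDensity ha) (powDensity_nonneg hα hr) hη fun x hx => ?_
  have h1 := norm_sub_norm_le (Complex.exp (r * η)) (x : ℂ)
  rw [Complex.norm_real, Real.norm_of_nonneg (hA.trans hx.1).le] at h1
  linarith [hx.2]

theorem exists_logDomain_limit (ha : 0 < a) (hab : a < b) (hα : ∀ k, 0 < α k)
    (hl : StrictMono l) (hr : 1 ≤ r) (hψ : 0 < ψ) (hψr : r * ψ ≤ Real.pi)
    (h₁ : ∀ k, Real.pi ≤ (l k + r) * ψ) (h₂ : ∀ k, (l k + r) * ψ ≤ Real.pi + ψ)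
    (hlr : ∀ k, 1 ≤ l k + r) (n : Fin N) (hn : ∀ k, k ≤ n) {f : ℂ → ℂ} {W : ℂ → ℝ}
    (hWc : Continuous W) (hWp : ∀ x : ℝ, W x = Real.pi * powDensity a b N α l r x)
    (hup : ∀ η : ℂ, 0 < η.im → η.im < Real.pi / r →
      f η = powCauchy a b N α l r (Complex.exp (r * η)))
    (hW : ∀ η ∈ logDomain a b r ψ, 0 ≤ η.im → (f η).im = -W (Complex.exp (r * η)))
    (hlow : ∀ η : ℂ, -ψ < η.im → η.im < 0 →
      f η = powCauchy a b N α l r (Complex.exp (r * η)) + jumpTerm a b N α l r η)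
    (hge : ∀ η : ℂ, -ψ < η.im → η.im < 0 → (jumpTerm a b N α l r η).im ≤ (f η).im)
    (𝒰 : Ultrafilter ℂ) (h𝒰 : ∀ᶠ z in (𝒰 : Filter ℂ), z ∈ logDomain a b r ψ) {w : ℂ}
    (hw : w.im < 0) (hf : Tendsto f 𝒰 (𝓝 w)) :
    ∃ z ∈ logDomain a b r ψ, (𝒰 : Filter ℂ) ≤ 𝓝 z := by
  have hr0 : 0 < r := by linarith
  have hb : 0 < b := ha.trans hab
  have hpi := Real.pi_pos
  have hA : 0 < a ^ r := Real.rpow_pos_of_pos ha r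
  have hψπ : ψ ≤ Real.pi := by nlinarith
  have hfim : Tendsto (fun η => (f η).im) 𝒰 (𝓝 w.im) := (Complex.continuous_im.tendsto _).comp hf
  have hW0 : ∀ x : ℝ, x ∉ Ioo (a ^ r) (b ^ r) → W x = 0 := fun x hx => by
    rw [hWp, powDensity_eq_zero ha hab hr hx, mul_zero]
  have hexp_notMem : ∀ x : ℝ, (x ≤ Real.log a ∨ Real.log b ≤ x) →
      Real.exp (r * x) ∉ Ioo (a ^ r) (b ^ r) := by
    rintro x hx ⟨h3, h4⟩
    rw [Real.rpow_def_of_pos ha, Real.exp_lt_exp] at h3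
    rw [Real.rpow_def_of_pos hb, Real.exp_lt_exp] at h4
    rcases hx with hx | hx <;> nlinarith
  have himle : ∀ᶠ z in (𝒰 : Filter ℂ), |z.im| ≤ Real.pi := by
    filter_upwards [h𝒰] with z hz
    have h3 : Real.pi / r ≤ Real.pi := div_le_self hpi.le hr
    rw [abs_le]
    constructor <;> linarith [hz.1.1, hz.1.2]
  have hcases := 𝒰.tendsto_re_or_le_nhds himle
  have hlim_im : ∀ z, (𝒰 : Filter ℂ) ≤ 𝓝 z → Tendsto Complex.im 𝒰 (𝓝 z.im) := fun z hz =>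
    (Complex.continuous_im.tendsto z).mono_left hz
  rcases 𝒰.em (fun z => 0 ≤ z.im) with h0 | h0
  · have hWlim : Tendsto (fun η : ℂ => -W (Complex.exp (r * η))) 𝒰 (𝓝 w.im) := by
      refine hfim.congr' ?_
      filter_upwards [h𝒰, h0] with η h3 h4 using hW η h3 h4
    rcases hcases with hre | hre | ⟨z, hz⟩
    · exfalso
      have h3 : Tendsto (fun η : ℂ => -W (Complex.exp (r * η))) 𝒰 (𝓝 (-W 0)) :=
        ((hWc.tendsto 0).comp (tendsto_cexp_mul_atBot hr0 hre)).neg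
      have h4 := tendsto_nhds_unique hWlim h3
      have h5 := hW0 0 fun h => hA.not_ge h.1.le
      rw [Complex.ofReal_zero] at h5
      rw [h5] at h4
      linarith
    · exfalso
      have h3 : Tendsto f 𝒰 (𝓝 0) := by
        refine (tendsto_powCauchy_atTop (b := b) (l := l) ha hα hr hre).congr' ?_
        filter_upwards [h𝒰, h0, hre.eventually_gt_atTop (Real.log b)] with η h4 h5 h6
        have h7 : η.im ≠ 0 := h4.2.resolve_right fun h => h.2.not_gt h6
        exact (hup η (lt_of_le_of_ne h5 h7.symm) h4.1.2).symm
      rw [tendsto_nhds_unique hf h3] at hw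
      simp at hw
    · refine ⟨z, ?_, hz⟩
      by_contra hzL
      have h3 : 0 ≤ z.im := ge_of_tendsto (hlim_im z hz) h0
      have h4 : z.im ≤ Real.pi / r :=
        le_of_tendsto (hlim_im z hz) (h𝒰.mono fun η hη => hη.1.2.le)
      have h5 : Tendsto (fun η : ℂ => -W (Complex.exp (r * η))) 𝒰
          (𝓝 (-W (Complex.exp (r * z)))) := by
        have : Continuous fun η : ℂ => -W (Complex.exp (r * η)) := by fun_prop
        exact (this.tendsto z).mono_left hz
      have h6 := tendsto_nhds_unique hWlim h5
      have h7 : W (Complex.exp (r * z)) = 0 := by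
        rcases h4.eq_or_lt with h4 | h4
        · have h8 : Complex.exp (r * z) = ((-Real.exp (r * z.re) : ℝ) : ℂ) := by
            have : r * z.im = Real.pi := by rw [h4]; field_simp
            apply Complex.ext <;> simp [Complex.exp_re, Complex.exp_im, this]
          rw [h8]
          refine hW0 _ fun h => ?_
          have := Real.exp_pos (r * z.re)
          linarith [h.1]
        · have h8 : ¬ (z.im ≠ 0 ∨ (Real.log a < z.re ∧ z.re < Real.log b)) := fun h =>
            hzL ⟨⟨by linarith, h4⟩, h⟩
          push Not at h8
          have h9 : Complex.exp (r * z) = ((Real.exp (r * z.re) : ℝ) : ℂ) := by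
            apply Complex.ext <;> simp [Complex.exp_re, Complex.exp_im, h8.1]
          rw [h9]
          refine hW0 _ (hexp_notMem _ ?_)
          rcases le_or_gt z.re (Real.log a) with h | h
          · exact Or.inl h
          · exact Or.inr (h8.2 h)
      rw [h7] at h6
      linarith
  · have hneg : ∀ᶠ z in (𝒰 : Filter ℂ), -ψ < z.im ∧ z.im < 0 := by
      filter_upwards [h𝒰, h0] with z h3 h4 using ⟨h3.1.1, not_le.1 h4⟩
    have hJ : ∀ᶠ η in (𝒰 : Filter ℂ), (jumpTerm a b N α l r η).im ≤ (f η).im :=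
      hneg.mono fun η hη => hge η hη.1 hη.2
    rcases hcases with hre | hre | ⟨z, hz⟩
    · exfalso
      have hq : 0 < l n + r := by linarith [hlr n]
      have h3 : Tendsto (fun η => Complex.exp (((l n + r : ℝ) : ℂ) * η) * f η) 𝒰 (𝓝 0) := by
        simpa using (tendsto_cexp_mul_atBot hq hre).mul hf
      have h4 := (tendsto_exp_mul_powCauchy (b := b) (l := l) ha hα hr hq hre).add
        (tendsto_exp_mul_jumpTerm (α := α) (r := r) ha hab hl n hn hre)
      have h5 := tendsto_nhds_unique h3 (h4.congr' (by
        filter_upwards [hneg] with η hη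
        rw [hlow η hη.1 hη.2, mul_add]))
      rw [zero_add, eq_comm, neg_eq_zero, Complex.ofReal_eq_zero] at h5
      have := hα n
      have := Real.sqrt_pos.2 ha
      have := Real.sqrt_pos.2 hb
      have : 0 < 2 * Real.pi / r * (α n * (√b * √a)) := by positivity
      linarith
    · exact absurd (le_of_tendsto_of_tendsto (tendsto_jumpTerm_im_atTop hlr hre) hfim hJ)
        hw.not_ge
    · refine ⟨z, ?_, hz⟩
      by_contra hzL
      have h3 : -ψ ≤ z.im := ge_of_tendsto (hlim_im z hz) (hneg.mono fun η hη => hη.1.le)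
      have h4 : z.im ≤ 0 := le_of_tendsto (hlim_im z hz) (hneg.mono fun η hη => hη.2.le)
      have h5 : Tendsto (fun η => (jumpTerm a b N α l r η).im) 𝒰
          (𝓝 (jumpTerm a b N α l r z).im) := by
        refine (Complex.continuous_im.tendsto _).comp
          ((continuousOn_jumpTerm z ⟨by linarith, h4⟩).mono_left (le_inf hz ?_))
        refine le_principal_iff.2 (hneg.mono fun η hη => ⟨?_, hη.2.le⟩)
        linarith [hη.1]
      have h6 := le_of_tendsto_of_tendsto h5 hfim hJ
      have h7 : 0 ≤ (jumpTerm a b N α l r z).im := by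
        rcases h3.eq_or_lt with h3 | h3
        · exact jumpTerm_im_nonneg ha hab hα hr0 hψ hψπ h₁ h₂ h3.symm
        · have h8 : ¬ (z.im ≠ 0 ∨ (Real.log a < z.re ∧ z.re < Real.log b)) := fun h =>
            hzL ⟨⟨h3, h4.trans_lt (by positivity)⟩, h⟩
          push Not at h8
          refine (jumpTerm_im_eq_zero ha hab h8.1 ?_).ge
          rcases le_or_gt z.re (Real.log a) with h | h
          · exact Or.inl h
          · exact Or.inr (h8.2 h)
      linarith
end

section
variable {a b : ℝ} {N : ℕ} {α l : Fin N → ℝ} {r ψ : ℝ}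

theorem cauchyTransform_map_rpow_GPFP (ha : 0 < a) (hab : a < b) (hα : ∀ k, 0 < α k) (hr : 1 ≤ r)
    {z : ℂ} (hz : z.im ≠ 0) :
    cauchyTransform (Measure.map (fun x : ℝ => x ^ r) (GPFP a b N α l)) z =
      powCauchy a b N α l r z := by
  have hne : ∀ x : ℝ, z - x ≠ 0 := fun x h => hz (by rw [sub_eq_zero.1 h, Complex.ofReal_im])
  exact integral_map_rpow_GPFP ha hab hα hr
    ((continuous_const.sub Complex.continuous_ofReal).inv₀ hne)

theorem integral_powDensity (ha : 0 < a) (hab : a < b) (hα : ∀ k, 0 < α k) (hr : 1 ≤ r)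
    [IsProbabilityMeasure (GPFP a b N α l)] :
    ∫ y in Ioo (a ^ r) (b ^ r), powDensity a b N α l r y = 1 := by
  have hm : Measurable fun x : ℝ => x ^ r :=
    (Real.continuous_rpow_const (show 0 ≤ r by linarith)).measurable
  have := Measure.isProbabilityMeasure_map (μ := GPFP a b N α l) hm.aemeasurable
  have h := integral_map_rpow_GPFP (N := N) (α := α) (l := l) ha hab hα hr
    (F := fun _ => (1 : ℂ)) continuous_const
  simp only [integral_const, probReal_univ, one_smul, mul_one] at h
  rw [integral_complex_ofReal] at h
  exact_mod_cast h.symm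

theorem exists_powCauchy_eq (ha : 0 < a) (hab : a < b) (hα : ∀ k, 0 < α k) (hr : 1 ≤ r)
    [IsProbabilityMeasure (GPFP a b N α l)]
    (hd : DifferentiableOn ℂ (powCauchy a b N α l r) {z | 0 < z.im}) :
    ∃ δ : ℝ, 0 < δ ∧ ∀ w : ℂ, |w.re| < -w.im → -δ < w.im →
      ∃ z : ℂ, 0 < z.im ∧ powCauchy a b N α l r z = w := by
  have hr0 : 0 < r := by linarith
  exact exists_eq_of_norm_sub_inv_le hd (K := 2 * b ^ r) (R := 2 * b ^ r) fun z hz hzB =>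
    norm_cauchy_sub_inv_le (Real.rpow_pos_of_pos ha r) (Real.rpow_lt_rpow ha.le hab hr0)
      (continuous_powDensity ha) (powDensity_nonneg hα hr) (integral_powDensity ha hab hα hr)
      hz.ne' hzB

theorem log_div_mem {r : ℝ} (hr : 0 < r) {z : ℂ} (hz : 0 < z.im) :
    0 < (Complex.log z / r).im ∧ (Complex.log z / r).im < Real.pi / r ∧
      Complex.exp (r * (Complex.log z / r)) = z := by
  have hz0 : z ≠ 0 := by rintro rfl; simp at hz
  have h0 : 0 < z.arg := by
    refine lt_of_le_of_ne (Complex.arg_nonneg_iff.2 hz.le) fun h => hz.ne' ?_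
    exact (Complex.arg_eq_zero_iff.1 h.symm).2
  have h1 : z.arg < Real.pi := lt_of_le_of_ne (Complex.arg_le_pi z) fun h =>
    hz.ne' (Complex.arg_eq_pi_iff.1 h).2
  rw [Complex.div_ofReal_im, Complex.log_im]
  refine ⟨div_pos h0 hr, by gcongr, ?_⟩
  rw [mul_div_cancel₀ _ (Complex.ofReal_ne_zero.2 hr.ne'), Complex.exp_log hz0]

theorem exists_logDomain_inverse (ha : 0 < a) (hab : a < b) (hα : ∀ k, 0 < α k)
    (hl : StrictMono l) (hr : 1 ≤ r) (hψ : 0 < ψ) (hψr : r * ψ ≤ Real.pi)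
    (h₁ : ∀ k, Real.pi ≤ (l k + r) * ψ) (h₂ : ∀ k, (l k + r) * ψ ≤ Real.pi + ψ)
    (hlr : ∀ k, 1 ≤ l k + r) (n : Fin N) (hn : ∀ k, k ≤ n)
    [IsProbabilityMeasure (GPFP a b N α l)] :
    ∃ (f F : ℂ → ℂ) (δ : ℝ), 0 < δ ∧ AnalyticOnNhd ℂ F {w | w.im < 0} ∧
      (∀ w : ℂ, w.im < 0 → F w ∈ logDomain a b r ψ ∧ f (F w) = w) ∧
      ∀ w : ℂ, |w.re| < -w.im → -δ < w.im →
        ∃ z : ℂ, 0 < z.im ∧ powCauchy a b N α l r z = w ∧ F w = Complex.log z / r := by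
  have hr0 : 0 < r := by linarith
  have hpi := Real.pi_pos
  have hψπ : ψ ≤ Real.pi := by nlinarith
  obtain ⟨f, W, hWc, hWp, ⟨M₁, hM₁⟩, hfd, hup, hW, hlow⟩ :=
    exists_logDomain_continuation (N := N) (α := α) (l := l) (ψ := ψ) ha hab hr hψr
  have hup_mem : ∀ η : ℂ, 0 < η.im → η.im < Real.pi / r → η ∈ logDomain a b r ψ :=
    fun η h3 h4 => ⟨⟨by linarith, h4⟩, Or.inl h3.ne'⟩
  have hlow_mem : ∀ η : ℂ, -ψ < η.im → η.im < 0 → η ∈ logDomain a b r ψ :=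
    fun η h3 h4 => ⟨⟨h3, h4.trans (by positivity)⟩, Or.inl h4.ne⟩
  have hge : ∀ η : ℂ, -ψ < η.im → η.im < 0 → (jumpTerm a b N α l r η).im ≤ (f η).im := by
    intro η h3 h4
    have h5 : (Complex.exp (r * η)).im < 0 := by
      rw [Complex.exp_real_mul_im]
      exact mul_neg_of_pos_of_neg (Real.exp_pos _)
        (Real.sin_neg_of_neg_of_neg_pi_lt (by nlinarith) (by nlinarith))
    have h6 := cauchy_im_nonneg (p := powDensity a b N α l r) (A := a ^ r) (B := b ^ r)
      (continuous_powDensity ha) (powDensity_nonneg (l := l) hα hr) h5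
    rw [hlow η h3 h4, Complex.add_im]
    exact le_add_of_nonneg_left h6
  have hlogf : ∀ z : ℂ, 0 < z.im → Complex.log z / r ∈ logDomain a b r ψ ∧
      f (Complex.log z / r) = powCauchy a b N α l r z := by
    intro z hz
    obtain ⟨h3, h4, h5⟩ := log_div_mem hr0 hz
    exact ⟨hup_mem _ h3 h4, by rw [hup _ h3 h4, h5]⟩
  have hCd : DifferentiableOn ℂ (powCauchy a b N α l r) {z | 0 < z.im} := by
    have h3 : DifferentiableOn ℂ (fun z => f (Complex.log z / r)) {z | 0 < z.im} :=
      hfd.comp (fun z hz => ((differentiableAt_id.clog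
        (Or.inr (ne_of_gt hz))).div_const _).differentiableWithinAt) fun z hz => (hlogf z hz).1
    exact h3.congr fun z hz => (hlogf z hz).2.symm
  obtain ⟨δ, hδ, hδw⟩ := exists_powCauchy_eq ha hab hα hr hCd
  have hpt : ∀ s : ℝ, 0 < s → s < δ → ∃ η ∈ logDomain a b r ψ, f η = (-s : ℝ) * Complex.I := by
    intro s hs hsδ
    obtain ⟨z, hz, hzw⟩ := hδw ((-s : ℝ) * Complex.I) (by simpa using hs) (by simpa using hsδ)
    exact ⟨_, (hlogf z hz).1, (hlogf z hz).2.trans hzw⟩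
  set q : ℝ := l n + r with hq
  have hq0 : 0 < q := by linarith [hlr n]
  set C₀ : ℝ := 2 * Real.pi / r * (α n * (√b * √a)) with hC₀
  have hC₀pos : 0 < C₀ := by
    have := hα n
    have := Real.sqrt_pos.2 ha
    have := Real.sqrt_pos.2 (ha.trans hab)
    positivity
  set V : Set ℂ := {η | -ψ < η.im ∧ η.im < 0} with hV
  have hgd : DifferentiableOn ℂ (fun η => Complex.exp (q * η) * f η) V :=
    DifferentiableOn.mul (by fun_prop) (hfd.mono fun η hη => hlow_mem η hη.1 hη.2)
  have hglim : Tendsto (fun η => Complex.exp (q * η) * f η) (comap Complex.re atBot ⊓ 𝓟 V)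
      (𝓝 (-C₀ : ℂ)) := by
    have hre : Tendsto Complex.re (comap Complex.re atBot ⊓ 𝓟 V) atBot :=
      tendsto_comap.mono_left inf_le_left
    have h4 := (tendsto_exp_mul_powCauchy (b := b) (l := l) ha hα hr hq0 hre).add
      (tendsto_exp_mul_jumpTerm (α := α) (r := r) ha hab hl n hn hre)
    rw [zero_add] at h4
    refine h4.congr' ?_
    filter_upwards [mem_inf_of_right (mem_principal_self V)] with η hη
    rw [hlow η hη.1 hη.2, mul_add]
  have hfg : ∀ η, Complex.exp (-q * η) * (Complex.exp (q * η) * f η) = f η := by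
    intro η
    rw [← mul_assoc, ← Complex.exp_add, neg_mul, neg_add_cancel, Complex.exp_zero, one_mul]
  obtain ⟨R, hR⟩ := exists_unique_exp_mul_eq hq0 hC₀pos (h₁ n) ((h₂ n).trans (by linarith)) hV
    hgd hglim
  simp only [hfg] at hR
  obtain ⟨M₂, hM₂⟩ := exists_jumpTerm_im_ge ha hab hα hr0 hlr R
  set M : ℝ := max (max M₁ M₂) 0 + 1 with hM
  have hM0 : 0 < M := by positivity
  have hMM₁ : M₁ < M := (((le_max_left _ _).trans (le_max_left _ _))).trans_lt (lt_add_one _)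
  have hMM₂ : M₂ < M := (((le_max_right _ _).trans (le_max_left _ _))).trans_lt (lt_add_one _)
  have hloc : ∀ z ∈ logDomain a b r ψ, f z = -Complex.I * M → z ∈ V ∧ z.re < R := by
    intro z hz hzM
    have him : (f z).im = -M := by rw [hzM]; simp
    have hneg : z.im < 0 := by
      by_contra! h
      have h3 := hW z hz h
      have := hM₁ (Complex.exp (r * z))
      linarith
    refine ⟨⟨hz.1.1, hneg⟩, ?_⟩
    by_contra! h
    have h3 := hM₂ z h
    have h4 := hge z hz.1.1 hneg
    linarith
  obtain ⟨F, hFa, hF, hFf⟩ := exists_analytic_inverse_of_proper isOpen_logDomain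
    (isPreconnected_logDomain ha hab hr0 hψ) hfd
    (isOpen_lt Complex.continuous_im continuous_const)
    (convex_halfSpace_im_lt 0).isPreconnected
    (by
      rintro ⟨w, hw⟩
      obtain ⟨η₁, hη₁, h3⟩ := hpt (δ / 2) (by linarith) (by linarith)
      obtain ⟨η₂, hη₂, h4⟩ := hpt (δ / 3) (by linarith) (by linarith)
      rw [hw _ hη₁] at h3
      rw [hw _ hη₂, h3] at h4
      have h5 := congrArg Complex.im h4
      simp at h5
      linarith)
    (fun 𝒰 h𝒰 w hw hf => exists_logDomain_limit ha hab hα hl hr hψ hψr h₁ h₂ hlr n hn hWc hWp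
      hup hW hlow hge 𝒰 h𝒰 hw hf)
    (by
      obtain ⟨η, hη, h3⟩ := hpt (δ / 2) (by linarith) (by linarith)
      refine ⟨η, hη, ?_⟩
      rw [h3]
      simpa using hδ)
    (w₀ := -Complex.I * M) (by simpa using hM0)
    (fun z hz z' hz' h3 h4 => by
      obtain ⟨h5, h6⟩ := hloc z hz h3
      obtain ⟨h7, h8⟩ := hloc z' hz' h4
      exact (hR M hM0 z h5 h6 h3).2 z' h7 h8 h4)
    (fun z hz h3 => by
      obtain ⟨h5, h6⟩ := hloc z hz h3
      exact (hR M hM0 z h5 h6 h3).1)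
  refine ⟨f, F, δ, hδ, hFa, fun w hw => hF w hw, fun w h3 h4 => ?_⟩
  obtain ⟨z, hz, hzw⟩ := hδw w h3 h4
  obtain ⟨h5, h6⟩ := hlogf z hz
  refine ⟨z, hz, hzw, ?_⟩
  have hw : w.im < 0 := by linarith [abs_nonneg w.re]
  have h7 := hFf _ h5 (by rw [h6, hzw]; exact hw)
  rwa [h6, hzw] at h7
end

/-- If `X ~ GPFP(a,b,N,α,l)` with `l ∈ [t,t+1]` for some `t ≥ 0`, then `X^r ∈ UI`
for every `r ≥ 1`. -/
theorem gpfp_power_UI (a b : ℝ) (ha : 0 < a) (hab : a < b)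
    (N : ℕ) (hN : 0 < N) (α l : Fin N → ℝ)
    (hα : ∀ k, 0 < α k) (hl : StrictMono l)
    (hprob : IsProbabilityMeasure (GPFP a b N α l))
    (t : ℝ) (ht : 0 ≤ t) (hlt : ∀ k, t ≤ l k ∧ l k ≤ t + 1)
    (r : ℝ) (hr : 1 ≤ r) :
    IsUI (Measure.map (fun x : ℝ => x ^ r) (GPFP a b N α l)) := by
  have hr0 : 0 < r := by linarith
  have hrt : 0 < r + t := by linarith
  have hpi := Real.pi_pos
  set ψ : ℝ := Real.pi / (r + t) with hψdef
  have hψ : 0 < ψ := by positivity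
  have hψeq : (r + t) * ψ = Real.pi := by rw [hψdef]; field_simp
  have hψr : r * ψ ≤ Real.pi := by nlinarith
  obtain ⟨f, F, δ, hδ, hFa, hF, hFc⟩ := exists_logDomain_inverse (ψ := ψ) ha hab hα hl hr hψ
    hψr (fun k => by nlinarith [(hlt k).1]) (fun k => by nlinarith [(hlt k).2])
    (fun k => by linarith [(hlt k).1]) ⟨N - 1, by omega⟩
    (fun k => Fin.mk_le_mk.2 (Nat.le_sub_one_of_lt k.2))
  refine ⟨fun w => Complex.exp (r * F w), ?_, ?_, 1, one_pos, δ, hδ, fun w h1 h2 => ?_⟩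
  · exact fun w hw => (analyticAt_const.mul (hFa w hw)).cexp
  · intro w hw w' hw' h
    have hlog : ∀ w : ℂ, w.im < 0 → Complex.log (Complex.exp (r * F w)) = r * F w := by
      intro w hw
      obtain ⟨⟨⟨h1, h2⟩, -⟩, -⟩ := hF w hw
      rw [lt_div_iff₀ hr0] at h2
      exact Complex.log_exp_real_mul (by nlinarith) (by linarith)
    have h3 : (r : ℂ) * F w = r * F w' := by
      rw [← hlog w hw, ← hlog w' hw']
      exact congrArg Complex.log h
    have h4 := mul_left_cancel₀ (Complex.ofReal_ne_zero.2 hr0.ne') h3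
    rw [← (hF w hw).2, h4, (hF w' hw').2]
  · rw [one_mul] at h1
    obtain ⟨z, hz, hzw, hFz⟩ := hFc w h1 h2
    have h3 : Complex.exp (r * F w) = z := by rw [hFz, (log_div_mem hr0 hz).2.2]
    simp only [h3]
    exact ⟨hz, by rw [cauchyTransform_map_rpow_GPFP ha hab hα hr hz.ne', hzw]⟩
end
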